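/- Consider the symmetric stochastic block model SSBM(n,2,a·ln(n)/n, b·ln(n)/n) with two communities and constants a,b ≥ 0. If |√a − √b| > √2, then exact recovery is solvable: there exists a sequence of estimators X̂_n mapping n-vertex graphs to {1,2}^n such that P(A(X, X̂_n(G)) = 1) → 1 as n → ∞. Conversely, if |√a − √b| < √2, then exact recovery is not solvable: for every sequence of estimators X̂_n, P(A(X, X̂_n(G)) = 1) does not tend to 1. -/

import Mathlib

open Filter
open scoped Classical

abbrev VPair (n : ℕ) := {e : Fin n × Fin n // e.1 < e.2}

noncomputable def sbmMass {n k : ℕ} (p : Fin k → ℝ) (W : Matrix (Fin k) (Fin k) ℝ)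
    (x : Fin n → Fin k) (g : VPair n → Bool) : ℝ :=
  (∏ u, p (x u)) *
    ∏ e : VPair n,
      if g e then W (x e.1.1) (x e.1.2) else 1 - W (x e.1.1) (x e.1.2)

noncomputable def sbmProb {n k : ℕ} (p : Fin k → ℝ) (W : Matrix (Fin k) (Fin k) ℝ)
    (E : (Fin n → Fin k) → (VPair n → Bool) → Prop) : ℝ :=
  ∑ x : Fin n → Fin k, ∑ g : VPair n → Bool,
    if E x g then sbmMass p W x g else 0

noncomputable def agreement {n k : ℕ} (x y : Fin n → Fin k) : ℝ :=
  (Finset.univ : Finset (Equiv.Perm (Fin k))).sup' ⟨1, Finset.mem_univ 1⟩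
    fun π => ((Finset.univ.filter fun i : Fin n => x i = π (y i)).card : ℝ) / n

def ssbmW (k : ℕ) (A B : ℝ) : Matrix (Fin k) (Fin k) ℝ :=
  Matrix.of fun i j => if i = j then A else B

section Likelihood

variable {n : ℕ} {p q : ℝ}

/-- The probability that the edge `e` has status `b`, given the labels `x`. -/
noncomputable def edgeWeight (p q : ℝ) (x : Fin n → Fin 2) (e : VPair n) (b : Bool) : ℝ :=
  if b then (if x e.1.1 = x e.1.2 then p else q) else 1 - (if x e.1.1 = x e.1.2 then p else q)

/-- The conditional probability of the graph `g`, given the labels `x`. -/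
noncomputable def likelihood (p q : ℝ) (x : Fin n → Fin 2) (g : VPair n → Bool) : ℝ :=
  ∏ e, edgeWeight p q x e (g e)

theorem edgeWeight_nonneg (hp : p ∈ Set.Icc (0 : ℝ) 1) (hq : q ∈ Set.Icc (0 : ℝ) 1)
    (x : Fin n → Fin 2) (e : VPair n) (b : Bool) : 0 ≤ edgeWeight p q x e b := by
  unfold edgeWeight
  split_ifs <;> linarith [hp.1, hp.2, hq.1, hq.2]

theorem sum_edgeWeight (p q : ℝ) (x : Fin n → Fin 2) (e : VPair n) :
    ∑ b, edgeWeight p q x e b = 1 := by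
  simp [edgeWeight]

theorem likelihood_nonneg (hp : p ∈ Set.Icc (0 : ℝ) 1) (hq : q ∈ Set.Icc (0 : ℝ) 1)
    (x : Fin n → Fin 2) (g : VPair n → Bool) : 0 ≤ likelihood p q x g :=
  Finset.prod_nonneg fun e _ => edgeWeight_nonneg hp hq x e (g e)

theorem sum_likelihood_mul_prod (p q : ℝ) (x : Fin n → Fin 2) (u : VPair n → Bool → ℝ) :
    ∑ g, likelihood p q x g * ∏ e, u e (g e) = ∏ e, ∑ b, edgeWeight p q x e b * u e b := by
  rw [Fintype.prod_sum]
  exact Finset.sum_congr rfl fun g _ => by rw [likelihood, ← Finset.prod_mul_distrib]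

theorem sum_likelihood (p q : ℝ) (x : Fin n → Fin 2) : ∑ g, likelihood p q x g = 1 := by
  have h := sum_likelihood_mul_prod p q x fun _ _ => 1
  simpa only [mul_one, Finset.prod_const_one, sum_edgeWeight] using h

theorem sbmMass_eq (p q : ℝ) (x : Fin n → Fin 2) (g : VPair n → Bool) :
    sbmMass (fun _ : Fin 2 => (1 : ℝ) / 2) (ssbmW 2 p q) x g
      = (1 / 2) ^ n * likelihood p q x g := by
  simp only [sbmMass, likelihood, edgeWeight, ssbmW, Matrix.of_apply, Finset.prod_const,
    Finset.card_univ, Fintype.card_fin]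

theorem sbmProb_eq (p q : ℝ) (E : (Fin n → Fin 2) → (VPair n → Bool) → Prop) :
    sbmProb (fun _ : Fin 2 => (1 : ℝ) / 2) (ssbmW 2 p q) E
      = (1 / 2) ^ n * ∑ x, ∑ g, if E x g then likelihood p q x g else 0 := by
  simp only [sbmProb, sbmMass_eq, Finset.mul_sum, mul_ite, mul_zero]

theorem sbmProb_eq_one_sub (p q : ℝ) (E : (Fin n → Fin 2) → (VPair n → Bool) → Prop) :
    sbmProb (fun _ : Fin 2 => (1 : ℝ) / 2) (ssbmW 2 p q) E
      = 1 - (1 / 2) ^ n * ∑ x, ∑ g, if E x g then 0 else likelihood p q x g := by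
  have h : ∑ x : Fin n → Fin 2, ∑ g, likelihood p q x g = 2 ^ n := by
    simp [sum_likelihood]
  have h2 : (∑ x, ∑ g, if E x g then likelihood p q x g else 0)
      + (∑ x, ∑ g, if E x g then 0 else likelihood p q x g)
      = ∑ x : Fin n → Fin 2, ∑ g, likelihood p q x g := by
    simp only [← Finset.sum_add_distrib]
    refine Finset.sum_congr rfl fun x _ => Finset.sum_congr rfl fun g _ => ?_
    split_ifs <;> simp
  rw [sbmProb_eq, eq_sub_iff_add_eq, ← mul_add, h2, h, ← mul_pow]
  norm_num

/-- Two labelings describe the same partition into two communities. -/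
def SamePartition (x y : Fin n → Fin 2) : Prop := x = y ∨ x = y + 1

theorem perm_fin_two_apply (π : Equiv.Perm (Fin 2)) :
    (∀ i, π i = i) ∨ ∀ i, π i = i + 1 := by
  revert π; decide

theorem agreement_eq_one_iff (hn : 0 < n) (x y : Fin n → Fin 2) :
    agreement x y = 1 ↔ SamePartition x y := by
  have hn' : (n : ℝ) ≠ 0 := by positivity
  have key : ∀ π : Equiv.Perm (Fin 2),
      ((Finset.univ.filter fun i : Fin n => x i = π (y i)).card : ℝ) / n = 1
        ↔ ∀ i, x i = π (y i) := by
    intro π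
    rw [div_eq_one_iff_eq hn', Nat.cast_inj]
    have := Finset.card_filter_eq_iff (s := (Finset.univ : Finset (Fin n)))
      (p := fun i => x i = π (y i))
    simpa using this
  have hle : ∀ π : Equiv.Perm (Fin 2),
      ((Finset.univ.filter fun i : Fin n => x i = π (y i)).card : ℝ) / n ≤ 1 := by
    intro π
    rw [div_le_one (by positivity)]
    exact_mod_cast (Finset.card_le_univ _).trans_eq (Fintype.card_fin n)
  constructor
  · intro h
    obtain ⟨π, -, hπ⟩ := Finset.exists_mem_eq_sup' (⟨1, Finset.mem_univ 1⟩ :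
      (Finset.univ : Finset (Equiv.Perm (Fin 2))).Nonempty)
      fun π => ((Finset.univ.filter fun i : Fin n => x i = π (y i)).card : ℝ) / n
    have h1 := (key π).1 (hπ.symm.trans h)
    rcases perm_fin_two_apply π with h2 | h2
    · exact Or.inl (funext fun i => by rw [h1, h2])
    · exact Or.inr (funext fun i => by rw [h1, h2]; rfl)
  · intro h
    refine le_antisymm (Finset.sup'_le _ _ fun π _ => hle π) ?_
    obtain ⟨π, hπ⟩ : ∃ π : Equiv.Perm (Fin 2), ∀ i, x i = π (y i) := by
      rcases h with h | h
      · exact ⟨1, fun i => by rw [h]; rfl⟩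
      · exact ⟨Equiv.addRight 1, fun i => by rw [h]; rfl⟩
    exact ((key π).2 hπ).ge.trans (Finset.le_sup' (fun π : Equiv.Perm (Fin 2) =>
      ((Finset.univ.filter fun i : Fin n => x i = π (y i)).card : ℝ) / n) (Finset.mem_univ π))

end Likelihood

section UpperBound

variable {n : ℕ} {p q : ℝ}

/-- The pairs of vertices with exactly one endpoint in `D`. -/
noncomputable def cutPairs (D : Finset (Fin n)) : Finset (VPair n) :=
  Finset.univ.filter fun e => ¬ (e.1.1 ∈ D ↔ e.1.2 ∈ D)

theorem card_cutPairs (D : Finset (Fin n)) : (cutPairs D).card = D.card * (n - D.card) := by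
  have hc : Dᶜ.card = n - D.card := by rw [Finset.card_compl, Fintype.card_fin]
  rw [← hc, ← Finset.card_product]
  refine Finset.card_bij
    (fun e _ => if e.1.1 ∈ D then (e.1.1, e.1.2) else (e.1.2, e.1.1)) ?_ ?_ ?_
  · rintro ⟨⟨u, v⟩, h⟩ he
    simp only [cutPairs, Finset.mem_filter, Finset.mem_univ, true_and] at he
    by_cases hu : u ∈ D <;> simp_all
  · rintro ⟨⟨u, v⟩, h⟩ he ⟨⟨u', v'⟩, h'⟩ he' heq
    simp only [cutPairs, Finset.mem_filter, Finset.mem_univ, true_and] at he he' heq h h'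
    by_cases hu : u ∈ D <;> by_cases hu' : u' ∈ D <;> simp_all <;> omega
  · rintro ⟨u, v⟩ huv
    simp only [Finset.mem_product, Finset.mem_compl] at huv
    have hne : u ≠ v := fun h => huv.2 (h ▸ huv.1)
    rcases lt_or_gt_of_ne hne with h | h
    · exact ⟨⟨(u, v), h⟩, by simp [cutPairs, huv], by simp [huv]⟩
    · exact ⟨⟨(v, u), h⟩, by simp [cutPairs, huv], by simp [huv]⟩

/-- The Bhattacharyya coefficient of two Bernoulli distributions. -/
noncomputable def bhattacharyya (p q : ℝ) : ℝ := √(p * q) + √((1 - p) * (1 - q))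

theorem bhattacharyya_le (hp : p ∈ Set.Icc (0 : ℝ) 1) (hq : q ∈ Set.Icc (0 : ℝ) 1) :
    bhattacharyya p q ≤ 1 - (√p - √q) ^ 2 / 2 := by
  have h1 : √((1 - p) * (1 - q)) ≤ 1 - (p + q) / 2 := by
    apply Real.sqrt_le_iff.2
    constructor
    · linarith [hp.2, hq.2]
    · nlinarith [sq_nonneg (p - q)]
  have h2 : (√p - √q) ^ 2 = p + q - 2 * √(p * q) := by
    rw [sub_sq, Real.sq_sqrt hp.1, Real.sq_sqrt hq.1, Real.sqrt_mul hp.1]; ring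
  rw [bhattacharyya, h2]
  linarith

theorem bhattacharyya_nonneg (p q : ℝ) : 0 ≤ bhattacharyya p q := by
  unfold bhattacharyya; positivity

theorem sum_sqrt_edgeWeight_mul (hp : p ∈ Set.Icc (0 : ℝ) 1) (hq : q ∈ Set.Icc (0 : ℝ) 1)
    (x y : Fin n → Fin 2) (e : VPair n) :
    ∑ b, √(edgeWeight p q x e b * edgeWeight p q y e b)
      = if e ∈ cutPairs (Finset.univ.filter fun i => x i ≠ y i) then bhattacharyya p q else 1 := by
  have hfin : ∀ s t s' t' : Fin 2, (¬ (s ≠ s' ↔ t ≠ t')) ↔ ¬ (s = t ↔ s' = t') := by decide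
  have h := hfin (x e.1.1) (x e.1.2) (y e.1.1) (y e.1.2)
  have hm : e ∈ cutPairs (Finset.univ.filter fun i => x i ≠ y i)
      ↔ ¬ (x e.1.1 = x e.1.2 ↔ y e.1.1 = y e.1.2) := by
    rw [← h]; simp [cutPairs]
  have h1 := hp.1; have h2 := hq.1
  have h3 : 0 ≤ 1 - p := by linarith [hp.2]
  have h4 : 0 ≤ 1 - q := by linarith [hq.2]
  rw [if_congr hm rfl rfl]
  by_cases hx : x e.1.1 = x e.1.2 <;> by_cases hy : y e.1.1 = y e.1.2 <;>
    simp [edgeWeight, bhattacharyya, hx, hy, Real.sqrt_mul_self, h1, h2, h3, h4, mul_comm]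

theorem sum_sqrt_likelihood_mul (hp : p ∈ Set.Icc (0 : ℝ) 1) (hq : q ∈ Set.Icc (0 : ℝ) 1)
    (x y : Fin n → Fin 2) :
    ∑ g, √(likelihood p q x g * likelihood p q y g)
      = bhattacharyya p q ^ ((Finset.univ.filter fun i => x i ≠ y i).card
          * (n - (Finset.univ.filter fun i => x i ≠ y i).card)) := by
  have h : ∀ g, √(likelihood p q x g * likelihood p q y g)
      = ∏ e, √(edgeWeight p q x e (g e) * edgeWeight p q y e (g e)) := by
    intro g
    rw [likelihood, likelihood, ← Finset.prod_mul_distrib]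
    have := edgeWeight_nonneg (n := n) hp hq
    exact Real.sqrt_prod _ fun e _ => mul_nonneg (this _ _ _) (this _ _ _)
  simp_rw [h]
  rw [← Fintype.prod_sum fun e b => √(edgeWeight p q x e b * edgeWeight p q y e b)]
  simp_rw [sum_sqrt_edgeWeight_mul hp hq]
  rw [Finset.prod_ite_mem, Finset.univ_inter, Finset.prod_const, card_cutPairs]

/-- The maximum likelihood estimator. -/
noncomputable def mle (p q : ℝ) (g : VPair n → Bool) : Fin n → Fin 2 :=
  (Finite.exists_max fun x => likelihood p q x g).choose

theorem likelihood_le_mle (p q : ℝ) (g : VPair n → Bool) (x : Fin n → Fin 2) :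
    likelihood p q x g ≤ likelihood p q (mle p q g) g :=
  (Finite.exists_max fun x => likelihood p q x g).choose_spec x

theorem labeling_ext {x y z : Fin n → Fin 2} (h : ∀ i, x i ≠ y i ↔ x i ≠ z i) : y = z := by
  have hfin : ∀ s t u : Fin 2, (s ≠ t ↔ s ≠ u) → t = u := by decide
  exact funext fun i => hfin _ _ _ (h i)

theorem samePartition_of_card {x y : Fin n → Fin 2}
    (h : (Finset.univ.filter fun i => x i ≠ y i).card = 0
      ∨ (Finset.univ.filter fun i => x i ≠ y i).card = n) : SamePartition x y := by
  rcases h with h | h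
  · left
    rw [Finset.card_eq_zero, Finset.filter_eq_empty_iff] at h
    exact funext fun i => by simpa using h (Finset.mem_univ i)
  · right
    have hfin : ∀ s t : Fin 2, s ≠ t → s = t + 1 := by decide
    have h' := Finset.card_filter_eq_iff.1 (h.trans (by simp :
      n = (Finset.univ : Finset (Fin n)).card))
    exact funext fun i => hfin _ _ (h' i (Finset.mem_univ i))

/-- The union bound for the failure of the maximum likelihood estimator. -/
theorem sum_mle_failure_le (hp : p ∈ Set.Icc (0 : ℝ) 1) (hq : q ∈ Set.Icc (0 : ℝ) 1)
    (x : Fin n → Fin 2) :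
    (∑ g, if SamePartition x (mle p q g) then 0 else likelihood p q x g)
      ≤ ∑ k ∈ Finset.range (n + 1),
          if k = 0 ∨ k = n then 0 else (n.choose k : ℝ) * bhattacharyya p q ^ (k * (n - k)) := by
  have hL := likelihood_nonneg (n := n) hp hq
  have h1 : ∀ g, (if SamePartition x (mle p q g) then 0 else likelihood p q x g)
      ≤ ∑ y, if SamePartition x y then 0 else √(likelihood p q x g * likelihood p q y g) := by
    intro g
    have hnn : ∀ y ∈ (Finset.univ : Finset (Fin n → Fin 2)), 0 ≤ if SamePartition x y then 0
        else √(likelihood p q x g * likelihood p q y g) := by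
      intro y _; split_ifs <;> positivity
    split_ifs with h
    · exact Finset.sum_nonneg hnn
    · refine le_trans ?_ (Finset.single_le_sum hnn (Finset.mem_univ (mle p q g)))
      rw [if_neg h]
      exact Real.le_sqrt_of_sq_le (by
        rw [sq]; exact mul_le_mul_of_nonneg_left (likelihood_le_mle p q g x) (hL x g))
  refine (Finset.sum_le_sum fun g _ => h1 g).trans ?_
  rw [Finset.sum_comm]
  let F : ℕ → ℝ := fun k => if k = 0 ∨ k = n then 0 else bhattacharyya p q ^ (k * (n - k))
  have hF : ∀ k, 0 ≤ F k := fun k => by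
    have := bhattacharyya_nonneg p q
    simp only [F]; split_ifs <;> positivity
  have h2 : ∀ y, (∑ g, if SamePartition x y then 0 else √(likelihood p q x g * likelihood p q y g))
      ≤ F (Finset.univ.filter fun i => x i ≠ y i).card := by
    intro y
    by_cases h : SamePartition x y
    · simpa [h] using hF _
    · simp only [h, if_false, F]
      rw [if_neg (fun hk => h (samePartition_of_card hk)), sum_sqrt_likelihood_mul hp hq]
  refine (Finset.sum_le_sum fun y _ => h2 y).trans ?_
  calc ∑ y : Fin n → Fin 2, F (Finset.univ.filter fun i => x i ≠ y i).card
      ≤ ∑ D ∈ (Finset.univ : Finset (Fin n)).powerset, F D.card := by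
        rw [Finset.powerset_univ]
        rw [← Finset.sum_image (s := Finset.univ) (f := fun D : Finset (Fin n) => F D.card)
          (g := fun y : Fin n → Fin 2 => Finset.univ.filter fun i => x i ≠ y i)]
        · exact Finset.sum_le_univ_sum_of_nonneg fun D => hF _
        · intro y _ z _ hyz
          exact labeling_ext fun i => by simpa using Finset.ext_iff.1 hyz i
    _ = _ := by
        rw [Finset.sum_powerset_apply_card F, Finset.card_univ, Fintype.card_fin]
        refine Finset.sum_congr rfl fun k _ => ?_
        simp only [F, nsmul_eq_mul, mul_ite, mul_zero]

end UpperBound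
section UpperBoundAsymptotics

theorem choose_mul_pow_le {n k : ℕ} {c ε ρ : ℝ} (hk : k ≠ 0) (hkn : k < n) (hc : 0 < c)
    (hρ0 : 0 ≤ ρ) (hρ : ρ ≤ Real.exp (-(c * Real.log n / n))) (hε : k ≤ ε * n) :
    (n.choose k : ℝ) * ρ ^ (k * (n - k)) ≤ Real.exp (-((c * (1 - ε) - 1) * Real.log n)) ^ k := by
  have hn : (0 : ℝ) < n := by exact_mod_cast Nat.zero_lt_of_lt hkn
  have hL : 0 ≤ Real.log n := Real.log_natCast_nonneg n
  have h1 : (n.choose k : ℝ) ≤ Real.exp (k * Real.log n) := by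
    rw [Real.exp_nat_mul, Real.exp_log hn]
    exact_mod_cast Nat.choose_le_pow n k
  have h2 : ρ ^ (k * (n - k)) ≤ Real.exp ((k * (n - k) : ℕ) * (-(c * Real.log n / n))) := by
    rw [Real.exp_nat_mul]; exact pow_le_pow_left₀ hρ0 hρ _
  refine (mul_le_mul h1 h2 (by positivity) (by positivity)).trans ?_
  rw [← Real.exp_add, ← Real.exp_nat_mul, Real.exp_le_exp]
  push_cast [Nat.cast_sub hkn.le]
  have h3 : (1 - ε) ≤ (n - k) / n := by
    rw [le_div_iff₀ hn]; linarith
  have h4 : (k : ℝ) * (n - k) * (-(c * Real.log n / n))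
      = -(k * c * Real.log n * ((n - k) / n)) := by
    field_simp
  rw [h4]
  have h5 : 0 ≤ k * c * Real.log n := by positivity
  nlinarith [mul_le_mul_of_nonneg_left h3 h5]

theorem choose_mul_pow_le_add {n k : ℕ} {c ε ρ : ℝ} (hk : k ≠ 0) (hkn : k < n) (hc : 0 < c)
    (hε0 : 0 < ε) (hρ0 : 0 ≤ ρ) (hρ : ρ ≤ Real.exp (-(c * Real.log n / n))) :
    (n.choose k : ℝ) * ρ ^ (k * (n - k))
      ≤ Real.exp (-((c * (1 - ε) - 1) * Real.log n)) ^ k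
        + Real.exp (-((c * (1 - ε) - 1) * Real.log n)) ^ (n - k)
        + n.choose k * Real.exp (-(c * ε ^ 2 * Real.log n * n)) := by
  have hn : (0 : ℝ) < n := by exact_mod_cast Nat.zero_lt_of_lt hkn
  have hL : 0 ≤ Real.log n := Real.log_natCast_nonneg n
  by_cases h1 : k ≤ ε * n
  · have := choose_mul_pow_le hk hkn hc hρ0 hρ h1
    have h2 := Real.exp_pos (-((c * (1 - ε) - 1) * Real.log n))
    have h3 : 0 ≤ n.choose k * Real.exp (-(c * ε ^ 2 * Real.log n * n)) := by positivity
    have h4 := pow_pos h2 (n - k)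
    linarith
  by_cases h2 : ((n - k : ℕ) : ℝ) ≤ ε * n
  · have := choose_mul_pow_le (k := n - k) (by omega) (by omega) hc hρ0 hρ h2
    rw [Nat.choose_symm hkn.le, Nat.sub_sub_self hkn.le, mul_comm (n - k)] at this
    have h2 := Real.exp_pos (-((c * (1 - ε) - 1) * Real.log n))
    have h3 : 0 ≤ n.choose k * Real.exp (-(c * ε ^ 2 * Real.log n * n)) := by positivity
    have h4 := pow_pos h2 k
    linarith
  push Not at h1 h2
  have h3 : ρ ^ (k * (n - k)) ≤ Real.exp (-(c * ε ^ 2 * Real.log n * n)) := by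
    refine (pow_le_pow_left₀ hρ0 hρ _).trans ?_
    rw [← Real.exp_nat_mul, Real.exp_le_exp]
    have h4 : ε * n * (ε * n) ≤ ((k * (n - k) : ℕ) : ℝ) := by
      push_cast
      exact mul_le_mul h1.le h2.le (by positivity) (by positivity)
    have h5 : 0 ≤ c * Real.log n / n := by positivity
    have h6 : c * ε ^ 2 * Real.log n * n = ε * n * (ε * n) * (c * Real.log n / n) := by
      field_simp
    rw [h6]
    nlinarith [mul_le_mul_of_nonneg_right h4 h5]
  have h4 := mul_le_mul_of_nonneg_left h3 (Nat.cast_nonneg (α := ℝ) (n.choose k))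
  have h5 : ∀ j, 0 ≤ Real.exp (-((c * (1 - ε) - 1) * Real.log n)) ^ j := fun j => by positivity
  linarith [h5 k, h5 (n - k)]

theorem sum_pow_le {r : ℝ} (h0 : 0 ≤ r) (h1 : r ≤ 1 / 2) (n : ℕ) :
    ∑ k ∈ Finset.range (n + 1), (if k = 0 then 0 else r ^ k) ≤ 2 * r := by
  rw [Finset.sum_range_succ']
  simp only [Nat.add_eq_zero_iff, one_ne_zero, and_false, if_false, if_true, add_zero]
  simp_rw [pow_succ]
  rw [← Finset.sum_mul]
  have h2 := geom_sum_mul_neg r n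
  have h3 : 0 ≤ r ^ n := by positivity
  have h4 : 0 ≤ ∑ i ∈ Finset.range n, r ^ i := Finset.sum_nonneg fun i _ => by positivity
  have h5 : ∑ i ∈ Finset.range n, r ^ i ≤ 2 := by nlinarith
  exact mul_le_mul_of_nonneg_right h5 h0

theorem sum_choose_mul_pow_le {n : ℕ} {c ε ρ : ℝ} (hc : 0 < c)
    (hε0 : 0 < ε) (hρ0 : 0 ≤ ρ) (hρ : ρ ≤ Real.exp (-(c * Real.log n / n)))
    (hr : Real.exp (-((c * (1 - ε) - 1) * Real.log n)) ≤ 1 / 2) :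
    (∑ k ∈ Finset.range (n + 1),
        if k = 0 ∨ k = n then 0 else (n.choose k : ℝ) * ρ ^ (k * (n - k)))
      ≤ 4 * Real.exp (-((c * (1 - ε) - 1) * Real.log n))
        + Real.exp (n * (Real.log 2 - c * ε ^ 2 * Real.log n)) := by
  set r := Real.exp (-((c * (1 - ε) - 1) * Real.log n)) with hrdef
  have hr0 : 0 < r := Real.exp_pos _
  set s := Real.exp (-(c * ε ^ 2 * Real.log n * n)) with hs
  let G : ℕ → ℝ := fun k => if k = 0 then 0 else r ^ k
  have hG : ∀ k, 0 ≤ G k := fun k => by simp only [G]; split_ifs <;> positivity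
  have hterm : ∀ k ∈ Finset.range (n + 1),
      (if k = 0 ∨ k = n then 0 else (n.choose k : ℝ) * ρ ^ (k * (n - k)))
        ≤ G k + G (n - k) + n.choose k * s := by
    intro k hk
    have hs0 : 0 ≤ n.choose k * s := by positivity
    split_ifs with h
    · have := hG k; have := hG (n - k); linarith
    · rw [Finset.mem_range] at hk
      push Not at h
      simp only [G, h.1, if_false, show n - k ≠ 0 by omega]
      exact choose_mul_pow_le_add h.1 (by omega) hc hε0 hρ0 hρ
  refine (Finset.sum_le_sum hterm).trans ?_
  rw [Finset.sum_add_distrib, Finset.sum_add_distrib, Finset.sum_flip G, ← Finset.sum_mul]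
  have h1 : ∑ k ∈ Finset.range (n + 1), G k ≤ 2 * r := sum_pow_le hr0.le hr n
  have h2 : (∑ k ∈ Finset.range (n + 1), (n.choose k : ℝ)) * s
      = Real.exp (n * (Real.log 2 - c * ε ^ 2 * Real.log n)) := by
    rw [← Nat.cast_sum, Nat.sum_range_choose, mul_sub, sub_eq_add_neg, Real.exp_add,
      Real.exp_nat_mul, Real.exp_log two_pos, hs]
    push_cast
    congr 2
    ring
  rw [h2]
  linarith

theorem tendsto_log_natCast_atTop : Tendsto (fun n : ℕ => Real.log n) atTop atTop :=
  Real.tendsto_log_atTop.comp tendsto_natCast_atTop_atTop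

theorem tendsto_log_div_natCast : Tendsto (fun n : ℕ => Real.log n / n) atTop (nhds 0) := by
  have h := Real.isLittleO_log_id_atTop.tendsto_div_nhds_zero.comp
    (tendsto_natCast_atTop_atTop (R := ℝ))
  exact h

theorem tendsto_mul_log_div_natCast (a : ℝ) :
    Tendsto (fun n : ℕ => a * Real.log n / n) atTop (nhds 0) := by
  simpa [mul_div_assoc] using tendsto_log_div_natCast.const_mul a

theorem eventually_mul_log_div_mem_Icc {a : ℝ} (ha : 0 ≤ a) {t : ℝ} (ht : 0 < t) :
    ∀ᶠ n : ℕ in atTop, a * Real.log n / n ∈ Set.Icc (0 : ℝ) t := by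
  filter_upwards [(tendsto_mul_log_div_natCast a).eventually_lt_const ht] with n hn
  exact ⟨by have := Real.log_natCast_nonneg n; positivity, hn.le⟩

theorem exact_recovery_of_lt {a b : ℝ} (ha : 0 ≤ a) (hb : 0 ≤ b)
    (hab : √2 < |√a - √b|) :
    Tendsto
      (fun n : ℕ =>
        sbmProb (fun _ : Fin 2 => (1 : ℝ) / 2)
          (ssbmW 2 (a * Real.log n / n) (b * Real.log n / n))
          fun x (g : VPair n → Bool) =>
            agreement x (mle (a * Real.log n / n) (b * Real.log n / n) g) = 1)
      atTop (nhds 1) := by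
  set c := (√a - √b) ^ 2 / 2 with hc
  have hc1 : 1 < c := by
    have h := Real.lt_sq_of_sqrt_lt hab
    rw [sq_abs] at h
    linarith
  obtain ⟨ε, hε0, hε1⟩ : ∃ ε : ℝ, 0 < ε ∧ 0 < c * (1 - ε) - 1 := by
    refine ⟨(c - 1) / (2 * c), by apply div_pos <;> linarith, ?_⟩
    have : c * (1 - (c - 1) / (2 * c)) - 1 = (c - 1) / 2 := by field_simp; ring
    linarith
  have hr : Tendsto (fun n : ℕ => Real.exp (-((c * (1 - ε) - 1) * Real.log n))) atTop (nhds 0) :=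
    Real.tendsto_exp_neg_atTop_nhds_zero.comp (tendsto_log_natCast_atTop.const_mul_atTop hε1)
  have hs : Tendsto (fun n : ℕ => Real.exp (n * (Real.log 2 - c * ε ^ 2 * Real.log n)))
      atTop (nhds 0) := by
    have h1 : Tendsto (fun n : ℕ => Real.log 2 - c * ε ^ 2 * Real.log n) atTop atBot :=
      tendsto_atBot_add_const_left _ _ (tendsto_neg_atTop_atBot.comp
        (tendsto_log_natCast_atTop.const_mul_atTop (by positivity : 0 < c * ε ^ 2)))
    exact Real.tendsto_exp_atBot.comp
      ((tendsto_natCast_atTop_atTop (R := ℝ)).atTop_mul_atBot₀ h1)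
  have hlim := (tendsto_const_nhds (x := (1 : ℝ))).sub ((hr.const_mul 4).add hs)
  rw [mul_zero, add_zero, sub_zero] at hlim
  refine tendsto_of_tendsto_of_tendsto_of_le_of_le' hlim tendsto_const_nhds ?_ ?_
  · filter_upwards [eventually_gt_atTop 0, eventually_mul_log_div_mem_Icc ha one_pos,
      eventually_mul_log_div_mem_Icc hb one_pos,
      hr.eventually_le_const (by norm_num : (0 : ℝ) < 1 / 2)] with n hn hp hq hrn
    have hn' : (0 : ℝ) < n := by exact_mod_cast hn
    have hρ : bhattacharyya (a * Real.log n / n) (b * Real.log n / n)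
        ≤ Real.exp (-(c * Real.log n / n)) := by
      refine (bhattacharyya_le hp hq).trans ((le_of_eq ?_).trans (Real.add_one_le_exp _))
      have hL : 0 ≤ Real.log n / n := by have := Real.log_natCast_nonneg n; positivity
      rw [mul_div_assoc, mul_div_assoc, Real.sqrt_mul ha, Real.sqrt_mul hb, ← sub_mul, mul_pow,
        Real.sq_sqrt hL, hc]
      ring
    have key := sum_choose_mul_pow_le (by linarith) hε0 (bhattacharyya_nonneg _ _) hρ hrn
    rw [sbmProb_eq_one_sub]
    simp_rw [agreement_eq_one_iff hn]
    refine sub_le_sub_left ?_ _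
    refine (mul_le_mul_of_nonneg_left (Finset.sum_le_sum fun x _ =>
      (sum_mle_failure_le hp hq x).trans key) (by positivity)).trans ?_
    rw [Finset.sum_const, Finset.card_univ, Fintype.card_fun, Fintype.card_fin, Fintype.card_fin,
      nsmul_eq_mul, ← mul_assoc, Nat.cast_pow, ← mul_pow]
    norm_num
  · filter_upwards [eventually_mul_log_div_mem_Icc ha one_pos,
      eventually_mul_log_div_mem_Icc hb one_pos] with n hp hq
    rw [sbmProb_eq_one_sub, sub_le_self_iff]
    refine mul_nonneg (by positivity) (Finset.sum_nonneg fun x _ => Finset.sum_nonneg fun g _ => ?_)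
    have := likelihood_nonneg hp hq x g
    split_ifs <;> simp [this]

end UpperBoundAsymptotics
section Ambiguity

variable {n : ℕ} {p q : ℝ}

/-- Flip the label of the vertex `i`. -/
def flipLabel (i : Fin n) (x : Fin n → Fin 2) : Fin n → Fin 2 := x + Pi.single i 1

theorem flipLabel_injective (i : Fin n) : Function.Injective (flipLabel i) :=
  add_left_injective _

theorem flipLabel_apply_self (i : Fin n) (x : Fin n → Fin 2) : flipLabel i x i = x i + 1 := by
  simp [flipLabel]

theorem flipLabel_apply_of_ne {i j : Fin n} (h : j ≠ i) (x : Fin n → Fin 2) :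
    flipLabel i x j = x j := by
  simp [flipLabel, h]

theorem flipLabel_add_one (i : Fin n) (x : Fin n → Fin 2) :
    flipLabel i (x + 1) = flipLabel i x + 1 := by
  simp only [flipLabel]; exact add_right_comm _ _ _

theorem likelihood_add_one (x : Fin n → Fin 2) (g : VPair n → Bool) :
    likelihood p q (x + 1) g = likelihood p q x g := by
  simp [likelihood, edgeWeight]

theorem SamePartition.likelihood_eq {x y : Fin n → Fin 2} (h : SamePartition x y)
    (g : VPair n → Bool) : likelihood p q x g = likelihood p q y g := by
  rcases h with rfl | rfl
  · rfl
  · exact likelihood_add_one y g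

theorem SamePartition.flipLabel {x y : Fin n → Fin 2} (h : SamePartition x y) (i : Fin n) :
    SamePartition (flipLabel i x) (flipLabel i y) := by
  rcases h with rfl | rfl
  · exact Or.inl rfl
  · exact Or.inr (flipLabel_add_one i y)

theorem not_samePartition_flipLabel (hn : 2 ≤ n) {x y : Fin n → Fin 2} (h : SamePartition x y)
    (i : Fin n) : ¬ SamePartition (_root_.flipLabel i x) y := by
  have : Nontrivial (Fin n) := Fin.nontrivial_iff_two_le.2 hn
  obtain ⟨j, hj⟩ := exists_ne i
  have hfin : ∀ s : Fin 2, s + 1 ≠ s := by decide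
  have hfin' : ∀ s : Fin 2, s + 1 + 1 = s := by decide
  intro h'
  have hi := flipLabel_apply_self i x
  have hj' := flipLabel_apply_of_ne hj x
  rcases h with rfl | rfl <;> rcases h' with h' | h' <;> rw [h'] at hi hj' <;>
    simp only [Pi.add_apply, Pi.one_apply, hfin'] at hi hj'
  · exact hfin _ hi.symm
  · exact hfin _ hj'
  · exact hfin _ hj'.symm
  · exact hfin _ hi

/-- The likelihood of `x` does not decrease when some single label is flipped. -/
def Ambiguous (p q : ℝ) (x : Fin n → Fin 2) (g : VPair n → Bool) : Prop :=
  ∃ i, likelihood p q x g ≤ likelihood p q (flipLabel i x) g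

theorem sum_ambiguous_le (hp : p ∈ Set.Icc (0 : ℝ) 1) (hq : q ∈ Set.Icc (0 : ℝ) 1) (hn : 2 ≤ n)
    (y : Fin n → Fin 2) (g : VPair n → Bool) :
    (∑ x, if Ambiguous p q x g then likelihood p q x g else 0)
      ≤ 2 * ∑ x, if SamePartition x y then 0 else likelihood p q x g := by
  have hL := fun x => likelihood_nonneg (n := n) hp hq x g
  have hfail : 0 ≤ ∑ x, if SamePartition x y then 0 else likelihood p q x g :=
    Finset.sum_nonneg fun x _ => by have := hL x; split_ifs <;> simp [this]
  have hsplit : (∑ x, if Ambiguous p q x g then likelihood p q x g else 0)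
      ≤ (∑ x, if SamePartition x y then 0 else likelihood p q x g)
        + ∑ x, if SamePartition x y ∧ Ambiguous p q x g then likelihood p q x g else 0 := by
    rw [← Finset.sum_add_distrib]
    refine Finset.sum_le_sum fun x _ => ?_
    have := hL x
    by_cases h1 : SamePartition x y <;> by_cases h2 : Ambiguous p q x g <;> simp [h1, h2, this]
  suffices h : (∑ x, if SamePartition x y ∧ Ambiguous p q x g then likelihood p q x g else 0)
      ≤ ∑ x, if SamePartition x y then 0 else likelihood p q x g by linarith
  by_cases hex : ∃ x, SamePartition x y ∧ Ambiguous p q x g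
  · obtain ⟨z, hz, i, hi⟩ := hex
    calc (∑ x, if SamePartition x y ∧ Ambiguous p q x g then likelihood p q x g else 0)
        ≤ ∑ x, if SamePartition x y then likelihood p q (flipLabel i x) g else 0 := by
          refine Finset.sum_le_sum fun x _ => ?_
          have := hL (flipLabel i x)
          by_cases h1 : SamePartition x y
          · have h2 : likelihood p q x g ≤ likelihood p q (flipLabel i x) g := by
              rw [h1.likelihood_eq, ← hz.likelihood_eq, (h1.flipLabel i).likelihood_eq,
                ← (hz.flipLabel i).likelihood_eq]
              exact hi
            by_cases h3 : Ambiguous p q x g <;> simp [h1, h2, h3, this]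
          · simp [h1]
      _ ≤ ∑ x, if SamePartition (flipLabel i x) y then 0 else likelihood p q (flipLabel i x) g := by
          refine Finset.sum_le_sum fun x _ => ?_
          have := hL (flipLabel i x)
          by_cases h1 : SamePartition x y
          · simp [h1, not_samePartition_flipLabel hn h1 i]
          · by_cases h2 : SamePartition (flipLabel i x) y <;> simp [h1, h2, this]
      _ = _ := Function.Bijective.sum_comp
          (Finite.injective_iff_bijective.1 (flipLabel_injective i))
          fun x => if SamePartition x y then 0 else likelihood p q x g
  · push Not at hex
    rw [Finset.sum_eq_zero fun x _ => if_neg fun h => hex x h.1 h.2]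
    exact hfail

end Ambiguity

section SecondMoment

/-- The second moment method for a family of events of equal probability. -/
theorem third_le_sum_of_second_moment {Ω ι : Type*} [Fintype Ω] (μ : Ω → ℝ)
    (hμ : ∀ ω, 0 ≤ μ ω) (I : Finset ι) (E : ι → Ω → Prop) (B : Ω → Prop) {P : ℝ}
    (hEB : ∀ a ∈ I, ∀ ω, E a ω → B ω)
    (hP : ∀ a ∈ I, ∑ ω, μ ω * (if E a ω then 1 else 0) = P)
    (hPP : ∀ a ∈ I, ∀ b ∈ I, a ≠ b →
      ∑ ω, μ ω * (if E a ω then 1 else 0) * (if E b ω then 1 else 0) ≤ 2 * P ^ 2)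
    (hI : 1 ≤ I.card * P) :
    1 / 3 ≤ ∑ ω, if B ω then μ ω else 0 := by
  let Z : Ω → ℝ := fun ω => ∑ a ∈ I, if E a ω then 1 else 0
  have hZ0 : ∀ ω, ¬ B ω → Z ω = 0 := fun ω h =>
    Finset.sum_eq_zero fun a ha => if_neg fun h' => h (hEB a ha ω h')
  have h1 : ∑ ω, μ ω * Z ω = I.card * P := by
    simp only [Z, Finset.mul_sum]
    rw [Finset.sum_comm, Finset.sum_congr rfl hP, Finset.sum_const, nsmul_eq_mul]
  have h2 : ∑ ω, μ ω * Z ω ^ 2 ≤ I.card * P + 2 * (I.card * P) ^ 2 := by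
    have hexp : ∑ ω, μ ω * Z ω ^ 2 = ∑ a ∈ I, ∑ b ∈ I,
        ∑ ω, μ ω * (if E a ω then 1 else 0) * (if E b ω then 1 else 0) := by
      have : ∀ ω, μ ω * Z ω ^ 2 = ∑ a ∈ I, ∑ b ∈ I,
          μ ω * (if E a ω then 1 else 0) * (if E b ω then 1 else 0) := by
        intro ω
        simp only [Z]
        rw [sq, Finset.sum_mul_sum, Finset.mul_sum]
        simp_rw [Finset.mul_sum, mul_assoc]
      simp_rw [this]
      rw [Finset.sum_comm]
      exact Finset.sum_congr rfl fun a _ => Finset.sum_comm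
    rw [hexp]
    have hle : ∀ a ∈ I, ∀ b ∈ I,
        ∑ ω, μ ω * (if E a ω then 1 else 0) * (if E b ω then 1 else 0)
          ≤ (if a = b then P else 0) + 2 * P ^ 2 := by
      intro a ha b hb
      by_cases hab : a = b
      · subst hab
        rw [if_pos rfl, ← hP a ha]
        refine le_trans (le_of_eq (Finset.sum_congr rfl fun ω _ => ?_))
          (le_add_of_nonneg_right (by positivity))
        split_ifs <;> simp
      · rw [if_neg hab, zero_add]; exact hPP a ha b hb hab
    refine (Finset.sum_le_sum fun a ha => Finset.sum_le_sum (hle a ha)).trans (le_of_eq ?_)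
    simp only [Finset.sum_add_distrib, Finset.sum_ite_eq, Finset.sum_const, nsmul_eq_mul]
    rw [Finset.sum_congr rfl fun a ha => if_pos ha, Finset.sum_const, nsmul_eq_mul]
    ring
  have hμB : ∀ ω, 0 ≤ if B ω then μ ω else 0 := fun ω => by
    have := hμ ω; split_ifs <;> simp [this]
  have hCS := Finset.sum_sq_le_sum_mul_sum_of_sq_le_mul Finset.univ
    (r := fun ω => μ ω * Z ω) (f := fun ω => if B ω then μ ω else 0)
    (g := fun ω => μ ω * Z ω ^ 2) (fun ω _ => hμB ω)
    (fun ω _ => mul_nonneg (hμ ω) (sq_nonneg _)) (fun ω _ => by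
      by_cases h : B ω
      · rw [if_pos h]; exact le_of_eq (by ring)
      · simp [h, hZ0 ω h])
  rw [h1] at hCS
  have hS : 0 ≤ ∑ ω, if B ω then μ ω else 0 := Finset.sum_nonneg fun ω _ => hμB ω
  have h3 := hCS.trans (mul_le_mul_of_nonneg_left h2 hS)
  set t := (I.card : ℝ) * P
  have h4 : t + 2 * t ^ 2 ≤ 3 * t ^ 2 := by nlinarith
  have h5 := h3.trans (mul_le_mul_of_nonneg_left h4 hS)
  have ht : 0 < t ^ 2 := by positivity
  by_contra! hlt
  nlinarith

end SecondMoment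
section StarEvents

variable {n : ℕ} {p q : ℝ}

/-- The pairs containing the vertex `i`. -/
noncomputable def incidentPairs (i : Fin n) : Finset (VPair n) :=
  Finset.univ.filter fun e => e.1.1 = i ∨ e.1.2 = i

/-- The endpoint of `e` other than `i`, for a pair `e` containing `i`. -/
def otherEnd (i : Fin n) (e : VPair n) : Fin n := if e.1.1 = i then e.1.2 else e.1.1

theorem mem_incidentPairs {i : Fin n} {e : VPair n} :
    e ∈ incidentPairs i ↔ e.1.1 = i ∨ e.1.2 = i := by
  simp [incidentPairs]

theorem prod_incidentPairs (i : Fin n) (h : Fin n → ℝ) :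
    ∏ e ∈ incidentPairs i, h (otherEnd i e) = ∏ j ∈ Finset.univ.erase i, h j := by
  refine Finset.prod_bij (fun e _ => otherEnd i e) ?_ ?_ ?_ fun _ _ => rfl
  · rintro ⟨⟨u, v⟩, huv⟩ he
    simp only [mem_incidentPairs] at he huv
    simp only [otherEnd, Finset.mem_erase, Finset.mem_univ, and_true]
    split_ifs with h1
    · exact h1 ▸ huv.ne'
    · exact h1
  · rintro ⟨⟨u, v⟩, huv⟩ he ⟨⟨u', v'⟩, huv'⟩ he' heq
    simp only [mem_incidentPairs, otherEnd] at he he' heq huv huv'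
    simp only [Subtype.mk.injEq, Prod.mk.injEq]
    split_ifs at heq <;> omega
  · intro j hj
    rw [Finset.mem_erase] at hj
    rcases lt_or_gt_of_ne hj.1 with h | h
    · exact ⟨⟨(j, i), h⟩, by simp [mem_incidentPairs], by simp [otherEnd, hj.1]⟩
    · exact ⟨⟨(i, j), h⟩, by simp [mem_incidentPairs], by simp [otherEnd]⟩

/-- The neighbourhood of the vertex `i` in `g` is `A`. -/
def IsNeighborhood (i : Fin n) (A : Finset (Fin n)) (g : VPair n → Bool) : Prop :=
  ∀ e ∈ incidentPairs i, g e = decide (otherEnd i e ∈ A)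

/-- The conditional probability that the neighbourhood of `i` is `A`, given the labels `x`. -/
noncomputable def starProb (p q : ℝ) (x : Fin n → Fin 2) (i : Fin n) (A : Finset (Fin n)) : ℝ :=
  ∏ j ∈ Finset.univ.erase i, if j ∈ A then (if x j = x i then p else q)
    else 1 - (if x j = x i then p else q)

theorem prod_incidentPairs_edgeWeight (x : Fin n → Fin 2) (i : Fin n) (A : Finset (Fin n)) :
    ∏ e ∈ incidentPairs i, edgeWeight p q x e (decide (otherEnd i e ∈ A)) = starProb p q x i A := by
  rw [starProb, ← prod_incidentPairs i fun j => if j ∈ A then (if x j = x i then p else q)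
    else 1 - (if x j = x i then p else q)]
  refine Finset.prod_congr rfl fun e he => ?_
  have h : x e.1.1 = x e.1.2 ↔ x (otherEnd i e) = x i := by
    rw [mem_incidentPairs] at he
    unfold otherEnd
    rcases he with he | he
    · rw [if_pos he, he]; exact eq_comm
    · rw [if_neg (he ▸ e.2.ne), he]
  simp only [edgeWeight, decide_eq_true_eq, if_congr h rfl rfl]

theorem starProb_nonneg (hp : p ∈ Set.Icc (0 : ℝ) 1) (hq : q ∈ Set.Icc (0 : ℝ) 1)
    (x : Fin n → Fin 2) (i : Fin n) (A : Finset (Fin n)) : 0 ≤ starProb p q x i A :=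
  Finset.prod_nonneg fun j _ => by split_ifs <;> linarith [hp.1, hp.2, hq.1, hq.2]

theorem starProb_flipLabel (x : Fin n → Fin 2) (i : Fin n) (A : Finset (Fin n)) :
    starProb p q (flipLabel i x) i A = starProb q p x i A := by
  refine Finset.prod_congr rfl fun j hj => ?_
  have hfin : ∀ s t : Fin 2, s = t + 1 ↔ ¬ s = t := by decide
  have h : flipLabel i x j = flipLabel i x i ↔ ¬ x j = x i := by
    rw [flipLabel_apply_self, flipLabel_apply_of_ne (Finset.ne_of_mem_erase hj), hfin]
  simp only [if_congr h rfl rfl, ite_not]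

theorem starProb_eq (x : Fin n → Fin 2) {i : Fin n} {A : Finset (Fin n)} {d d' S : ℕ} (hi : i ∉ A)
    (hS : (Finset.univ.filter fun j => x j = x i).card = S)
    (hd : (A.filter fun j => x j = x i).card = d)
    (hd' : (A.filter fun j => ¬ x j = x i).card = d') :
    starProb p q x i A
      = p ^ d * (1 - p) ^ (S - 1 - d) * (q ^ d' * (1 - q) ^ (n - S - d')) := by
  have hprod : ∀ (s : Finset (Fin n)) (c : ℝ), ∏ j ∈ s, (if j ∈ A then c else 1 - c)
      = c ^ (s ∩ A).card * (1 - c) ^ (s.card - (s ∩ A).card) := by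
    intro s c
    rw [Finset.prod_ite, Finset.prod_const, Finset.prod_const, Finset.filter_mem_eq_inter]
    congr 2
    have := Finset.card_filter_add_card_filter_not (s := s) (fun j => j ∈ A)
    rw [Finset.filter_mem_eq_inter] at this
    omega
  rw [starProb, ← Finset.prod_filter_mul_prod_filter_not _ fun j => x j = x i]
  have h1 : ∀ c : ℝ, (∏ j ∈ (Finset.univ.erase i).filter fun j => x j = x i,
      if j ∈ A then c else 1 - c) = c ^ d * (1 - c) ^ (S - 1 - d) := by
    intro c
    rw [hprod]
    have e1 : ((Finset.univ.erase i).filter fun j => x j = x i) ∩ A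
        = A.filter fun j => x j = x i := by
      ext j
      simp only [Finset.mem_inter, Finset.mem_filter, Finset.mem_erase, Finset.mem_univ, and_true]
      exact ⟨fun h => ⟨h.2, h.1.2⟩, fun h => ⟨⟨fun h' => hi (h' ▸ h.1), h.2⟩, h.1⟩⟩
    have e2 : ((Finset.univ.erase i).filter fun j => x j = x i).card = S - 1 := by
      rw [Finset.filter_erase, Finset.card_erase_of_mem (by simp), hS]
    rw [e1, e2, hd]
  have h2 : ∀ c : ℝ, (∏ j ∈ (Finset.univ.erase i).filter fun j => ¬ x j = x i,
      if j ∈ A then c else 1 - c) = c ^ d' * (1 - c) ^ (n - S - d') := by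
    intro c
    rw [hprod]
    have e1 : ((Finset.univ.erase i).filter fun j => ¬ x j = x i) ∩ A
        = A.filter fun j => ¬ x j = x i := by
      ext j
      simp only [Finset.mem_inter, Finset.mem_filter, Finset.mem_erase, Finset.mem_univ, and_true]
      exact ⟨fun h => ⟨h.2, h.1.2⟩, fun h => ⟨⟨fun h' => hi (h' ▸ h.1), h.2⟩, h.1⟩⟩
    have e2 : ((Finset.univ.erase i).filter fun j => ¬ x j = x i).card = n - S := by
      rw [Finset.filter_erase, Finset.erase_eq_of_notMem (by simp)]
      have := Finset.card_filter_add_card_filter_not (s := (Finset.univ : Finset (Fin n)))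
        (fun j => x j = x i)
      rw [hS, Finset.card_univ, Fintype.card_fin] at this
      omega
    rw [e1, e2, hd']
  rw [← h1 p, ← h2 q]
  congr 1 <;> refine Finset.prod_congr rfl fun j hj => ?_ <;> simp [(Finset.mem_filter.1 hj).2]

/-- The part of the indicator function of `IsNeighborhood i A` that depends on the pair `e`. -/
noncomputable def neighborhoodFactor (i : Fin n) (A : Finset (Fin n)) (e : VPair n) (b : Bool) :
    ℝ :=
  if e ∈ incidentPairs i → b = decide (otherEnd i e ∈ A) then 1 else 0

theorem indicator_isNeighborhood (i : Fin n) (A : Finset (Fin n)) (g : VPair n → Bool) :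
    (if IsNeighborhood i A g then (1 : ℝ) else 0) = ∏ e, neighborhoodFactor i A e (g e) := by
  simp only [neighborhoodFactor, Fintype.prod_ite_zero, Finset.prod_const_one, IsNeighborhood]
  congr

theorem sum_edgeWeight_mul_factor (x : Fin n → Fin 2) (i : Fin n) (A : Finset (Fin n))
    (e : VPair n) :
    ∑ b, edgeWeight p q x e b * neighborhoodFactor i A e b
      = if e ∈ incidentPairs i then edgeWeight p q x e (decide (otherEnd i e ∈ A)) else 1 := by
  unfold neighborhoodFactor
  split_ifs with h
  · simp [h]
  · simpa [h] using sum_edgeWeight p q x e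

theorem sum_likelihood_isNeighborhood (x : Fin n → Fin 2) (i : Fin n) (A : Finset (Fin n)) :
    ∑ g, likelihood p q x g * (if IsNeighborhood i A g then 1 else 0) = starProb p q x i A := by
  simp_rw [indicator_isNeighborhood]
  rw [sum_likelihood_mul_prod, ← prod_incidentPairs_edgeWeight]
  simp_rw [sum_edgeWeight_mul_factor]
  rw [Finset.prod_ite_mem, Finset.univ_inter]

theorem card_incidentPairs_inter_le {i j : Fin n} (hij : i ≠ j) :
    (incidentPairs i ∩ incidentPairs j).card ≤ 1 := by
  rw [Finset.card_le_one]
  rintro ⟨⟨u, v⟩, huv⟩ h ⟨⟨u', v'⟩, huv'⟩ h'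
  simp only [Finset.mem_inter, mem_incidentPairs] at h h' huv huv'
  simp only [Subtype.mk.injEq, Prod.mk.injEq]
  omega

/-- Neighbourhoods of two vertices of the same community are nearly independent. -/
theorem sum_likelihood_isNeighborhood_pair_le (hp : p ∈ Set.Icc (0 : ℝ) (1 / 2))
    (hq : q ∈ Set.Icc (0 : ℝ) 1) (x : Fin n → Fin 2) {i j : Fin n} {A A' : Finset (Fin n)}
    (hij : i ≠ j) (hx : x i = x j) (hj : j ∉ A) (hi : i ∉ A') :
    ∑ g, likelihood p q x g * (if IsNeighborhood i A g then 1 else 0)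
        * (if IsNeighborhood j A' g then 1 else 0)
      ≤ 2 * (starProb p q x i A * starProb p q x j A') := by
  have hp1 : p ∈ Set.Icc (0 : ℝ) 1 := ⟨hp.1, by linarith [hp.2]⟩
  have hw := edgeWeight_nonneg (n := n) hp1 hq x
  simp_rw [indicator_isNeighborhood, mul_assoc, ← Finset.prod_mul_distrib]
  rw [sum_likelihood_mul_prod p q x fun e b =>
    neighborhoodFactor i A e b * neighborhoodFactor j A' e b]
  have hu : ∀ i A e b, 0 ≤ neighborhoodFactor (n := n) i A e b := fun i A e b => by
    unfold neighborhoodFactor; split_ifs <;> norm_num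
  have hfactor : ∀ e : VPair n,
      ∑ b, edgeWeight p q x e b * (neighborhoodFactor i A e b * neighborhoodFactor j A' e b)
        ≤ (if e ∈ incidentPairs i ∩ incidentPairs j then 2 else 1)
          * ((∑ b, edgeWeight p q x e b * neighborhoodFactor i A e b)
            * ∑ b, edgeWeight p q x e b * neighborhoodFactor j A' e b) := by
    intro e
    rw [sum_edgeWeight_mul_factor, sum_edgeWeight_mul_factor]
    by_cases h1 : e ∈ incidentPairs i <;> by_cases h2 : e ∈ incidentPairs j
    · rw [if_pos (Finset.mem_inter.2 ⟨h1, h2⟩), if_pos h1, if_pos h2]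
      have h1' := mem_incidentPairs.1 h1
      have h2' := mem_incidentPairs.1 h2
      have hlt := e.2
      have hcase : (e.1.1 = i ∧ e.1.2 = j) ∨ (e.1.1 = j ∧ e.1.2 = i) := by
        rcases h1' with h1' | h1' <;> rcases h2' with h2' | h2'
        · exact absurd (h1'.symm.trans h2') hij
        · exact Or.inl ⟨h1', h2'⟩
        · exact Or.inr ⟨h2', h1'⟩
        · exact absurd (h1'.symm.trans h2') hij
      have ho1 : otherEnd i e = j := by
        unfold otherEnd
        rcases hcase with h | h
        · rw [if_pos h.1, h.2]
        · rw [if_neg (h.1 ▸ hij.symm), h.1]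
      have ho2 : otherEnd j e = i := by
        unfold otherEnd
        rcases hcase with h | h
        · rw [if_neg (h.1 ▸ hij), h.1]
        · rw [if_pos h.1, h.2]
      have hs : x e.1.1 = x e.1.2 := by
        rcases hcase with h | h <;> rw [h.1, h.2, hx]
      simp only [neighborhoodFactor, h1, h2, ho1, ho2, hj, hi, Fintype.sum_bool, edgeWeight, hs,
        decide_false, forall_const, if_true, if_false, Bool.false_eq_true, reduceCtorEq]
      nlinarith [hp.1, hp.2]
    · have : ∀ b, neighborhoodFactor j A' e b = 1 := fun b => by simp [neighborhoodFactor, h2]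
      simp only [this, mul_one, sum_edgeWeight_mul_factor, h1, h2, Finset.mem_inter, and_false,
        if_false, if_true, one_mul, le_refl]
    · have : ∀ b, neighborhoodFactor i A e b = 1 := fun b => by simp [neighborhoodFactor, h1]
      simp only [this, one_mul, sum_edgeWeight_mul_factor, h1, h2, Finset.mem_inter, false_and,
        if_false, if_true, le_refl]
    · simp [neighborhoodFactor, h1, h2, edgeWeight]
  refine (Finset.prod_le_prod (fun e _ => Finset.sum_nonneg fun b _ =>
    mul_nonneg (hw e b) (mul_nonneg (hu _ _ _ _) (hu _ _ _ _))) fun e _ => hfactor e).trans ?_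
  rw [Finset.prod_mul_distrib, Finset.prod_mul_distrib, ← sum_likelihood_mul_prod,
    ← sum_likelihood_mul_prod]
  simp_rw [← indicator_isNeighborhood]
  rw [sum_likelihood_isNeighborhood, sum_likelihood_isNeighborhood, Finset.prod_ite_mem,
    Finset.univ_inter, Finset.prod_const]
  refine mul_le_mul_of_nonneg_right ?_
    (mul_nonneg (starProb_nonneg hp1 hq _ _ _) (starProb_nonneg hp1 hq _ _ _))
  calc (2 : ℝ) ^ (incidentPairs i ∩ incidentPairs j).card ≤ 2 ^ 1 :=
        pow_le_pow_right₀ (by norm_num) (card_incidentPairs_inter_le hij)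
    _ = 2 := pow_one 2

theorem IsNeighborhood.eq {i : Fin n} {A A' : Finset (Fin n)} {g : VPair n → Bool}
    (h : IsNeighborhood i A g) (h' : IsNeighborhood i A' g) (hi : i ∉ A) (hi' : i ∉ A') :
    A = A' := by
  ext j
  rcases lt_trichotomy i j with hij | rfl | hij
  · have he : (⟨(i, j), hij⟩ : VPair n) ∈ incidentPairs i := by simp [mem_incidentPairs]
    simpa [otherEnd] using (h _ he).symm.trans (h' _ he)
  · simp [hi, hi']
  · have he : (⟨(j, i), hij⟩ : VPair n) ∈ incidentPairs i := by simp [mem_incidentPairs]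
    simpa [otherEnd, hij.ne] using (h _ he).symm.trans (h' _ he)

theorem IsNeighborhood.exists_likelihood_eq {i : Fin n} {A : Finset (Fin n)} {g : VPair n → Bool}
    (hp : p ∈ Set.Icc (0 : ℝ) 1) (hq : q ∈ Set.Icc (0 : ℝ) 1)
    (h : IsNeighborhood i A g) (x : Fin n → Fin 2) :
    ∃ R, 0 ≤ R ∧ likelihood p q x g = starProb p q x i A * R
      ∧ likelihood p q (flipLabel i x) g = starProb q p x i A * R := by
  refine ⟨∏ e ∈ (incidentPairs i)ᶜ, edgeWeight p q x e (g e),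
    Finset.prod_nonneg fun e _ => edgeWeight_nonneg hp hq x e (g e), ?_, ?_⟩
  · rw [likelihood, ← Finset.prod_mul_prod_compl (incidentPairs i),
      ← prod_incidentPairs_edgeWeight]
    congr 1
    exact Finset.prod_congr rfl fun e he => by rw [h e he]
  · rw [likelihood, ← Finset.prod_mul_prod_compl (incidentPairs i), ← starProb_flipLabel,
      ← prod_incidentPairs_edgeWeight]
    congr 1
    · exact Finset.prod_congr rfl fun e he => by rw [h e he]
    · refine Finset.prod_congr rfl fun e he => ?_
      rw [Finset.mem_compl, mem_incidentPairs, not_or] at he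
      simp only [edgeWeight, flipLabel_apply_of_ne he.1, flipLabel_apply_of_ne he.2]

end StarEvents
section AmbiguityProbability

variable {n : ℕ} {p q : ℝ}

theorem mul_pow_le_of_swap (hp : p ∈ Set.Icc (0 : ℝ) 1) (hq : q ∈ Set.Icc (0 : ℝ) 1) {s t d : ℕ}
    (hs : d ≤ s) (ht : d ≤ t) (h : (q ≤ p ∧ t ≤ s) ∨ (p ≤ q ∧ s ≤ t)) :
    p ^ d * (1 - p) ^ (s - d) * (q ^ d * (1 - q) ^ (t - d))
      ≤ q ^ d * (1 - q) ^ (s - d) * (p ^ d * (1 - p) ^ (t - d)) := by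
  have hp0 := hp.1
  have hq0 := hq.1
  have hp1 : 0 ≤ 1 - p := by linarith [hp.2]
  have hq1 : 0 ≤ 1 - q := by linarith [hq.2]
  rcases h with ⟨hqp, hts⟩ | ⟨hpq, hst⟩
  · obtain ⟨k, rfl⟩ := Nat.exists_eq_add_of_le hts
    have hk : (1 - p) ^ k ≤ (1 - q) ^ k := pow_le_pow_left₀ hp1 (by linarith) k
    rw [show t + k - d = t - d + k by omega, pow_add, pow_add]
    calc p ^ d * ((1 - p) ^ (t - d) * (1 - p) ^ k) * (q ^ d * (1 - q) ^ (t - d))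
        = (p ^ d * (1 - p) ^ (t - d) * (q ^ d * (1 - q) ^ (t - d))) * (1 - p) ^ k := by ring
      _ ≤ (p ^ d * (1 - p) ^ (t - d) * (q ^ d * (1 - q) ^ (t - d))) * (1 - q) ^ k :=
          mul_le_mul_of_nonneg_left hk (by positivity)
      _ = _ := by ring
  · obtain ⟨k, rfl⟩ := Nat.exists_eq_add_of_le hst
    have hk : (1 - q) ^ k ≤ (1 - p) ^ k := pow_le_pow_left₀ hq1 (by linarith) k
    rw [show s + k - d = s - d + k by omega, pow_add, pow_add]
    calc p ^ d * (1 - p) ^ (s - d) * (q ^ d * ((1 - q) ^ (s - d) * (1 - q) ^ k))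
        = (p ^ d * (1 - p) ^ (s - d) * (q ^ d * (1 - q) ^ (s - d))) * (1 - q) ^ k := by ring
      _ ≤ (p ^ d * (1 - p) ^ (s - d) * (q ^ d * (1 - q) ^ (s - d))) * (1 - p) ^ k :=
          mul_le_mul_of_nonneg_left hk (by positivity)
      _ = _ := by ring

theorem choose_mul_choose_le_card (x : Fin n → Fin 2) {c : Fin 2} {H : Finset (Fin n)} {S m d : ℕ}
    (hS : (Finset.univ.filter fun j => x j = c).card = S)
    (hH : H ⊆ Finset.univ.filter fun j => x j = c) (hm : H.card = m) :
    (S - m).choose d * (n - S).choose d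
      ≤ (Finset.univ.filter fun A : Finset (Fin n) => Disjoint A H
          ∧ (A.filter fun j => x j = c).card = d
          ∧ (A.filter fun j => ¬ x j = c).card = d).card := by
  set U := Finset.univ.filter fun j => x j = c with hU
  set V := Finset.univ.filter fun j => ¬ x j = c with hV
  have hVc : V.card = n - S := by
    have := Finset.card_filter_add_card_filter_not (s := (Finset.univ : Finset (Fin n)))
      (fun j => x j = c)
    change U.card + V.card = _ at this
    rw [hS, Finset.card_univ, Fintype.card_fin] at this
    omega
  have hUH : (U \ H).card = S - m := by rw [Finset.card_sdiff_of_subset hH, hS, hm]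
  rw [← hUH, ← hVc, ← Finset.card_powersetCard, ← Finset.card_powersetCard, ← Finset.card_product]
  have hf1 : ∀ A ∈ Finset.powersetCard d (U \ H) ×ˢ Finset.powersetCard d V,
      (A.1 ∪ A.2).filter (fun j => x j = c) = A.1 := by
    intro A hA
    simp only [Finset.mem_product, Finset.mem_powersetCard] at hA
    ext j
    have h1 := @hA.1.1 j
    have h2 := @hA.2.1 j
    simp only [U, V, Finset.mem_sdiff, Finset.mem_filter, Finset.mem_univ, true_and] at h1 h2
    simp only [Finset.mem_filter, Finset.mem_union]
    tauto
  have hf2 : ∀ A ∈ Finset.powersetCard d (U \ H) ×ˢ Finset.powersetCard d V,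
      (A.1 ∪ A.2).filter (fun j => ¬ x j = c) = A.2 := by
    intro A hA
    simp only [Finset.mem_product, Finset.mem_powersetCard] at hA
    ext j
    have h1 := @hA.1.1 j
    have h2 := @hA.2.1 j
    simp only [U, V, Finset.mem_sdiff, Finset.mem_filter, Finset.mem_univ, true_and] at h1 h2
    simp only [Finset.mem_filter, Finset.mem_union]
    tauto
  refine Finset.card_le_card_of_injOn (fun A => A.1 ∪ A.2) ?_ ?_
  · intro A hA
    have hA' := hA
    rw [Finset.mem_coe] at hA
    simp only [Finset.mem_coe, Finset.mem_product, Finset.mem_powersetCard] at hA'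
    simp only [Finset.mem_coe, Finset.mem_filter, Finset.mem_univ, true_and]
    rw [hf1 A hA, hf2 A hA]
    refine ⟨?_, hA'.1.2, hA'.2.2⟩
    rw [Finset.disjoint_left]
    intro j hj hjH
    rcases Finset.mem_union.1 hj with hj | hj
    · exact (Finset.mem_sdiff.1 (hA'.1.1 hj)).2 hjH
    · exact (Finset.mem_filter.1 (hA'.2.1 hj)).2 (Finset.mem_filter.1 (hH hjH)).2
  · intro A hA B hB hAB
    rw [Finset.mem_coe] at hA hB
    have hAB' : A.1 ∪ A.2 = B.1 ∪ B.2 := hAB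
    exact Prod.ext (by rw [← hf1 A hA, ← hf1 B hB, hAB']) (by rw [← hf2 A hA, ← hf2 B hB, hAB'])

theorem third_le_sum_ambiguous (hp : p ∈ Set.Icc (0 : ℝ) (1 / 2)) (hq : q ∈ Set.Icc (0 : ℝ) (1 / 2))
    (x : Fin n → Fin 2) {c : Fin 2} {S m d : ℕ}
    (hS : (Finset.univ.filter fun j => x j = c).card = S) (hmd : m + d ≤ S) (hd : d ≤ n - S)
    (hpq : (q ≤ p ∧ n - S ≤ S - 1) ∨ (p ≤ q ∧ S - 1 ≤ n - S))
    (hN : 1 ≤ (m * (S - m).choose d * (n - S).choose d : ℝ)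
      * (p ^ d * (1 - p) ^ (S - 1 - d) * (q ^ d * (1 - q) ^ (n - S - d)))) :
    1 / 3 ≤ ∑ g, if Ambiguous p q x g then likelihood p q x g else 0 := by
  have hp1 : p ∈ Set.Icc (0 : ℝ) 1 := ⟨hp.1, by linarith [hp.2]⟩
  have hq1 : q ∈ Set.Icc (0 : ℝ) 1 := ⟨hq.1, by linarith [hq.2]⟩
  have hm0 : 1 ≤ m := by
    by_contra! h
    rw [Nat.lt_one_iff.1 h] at hN
    norm_num at hN
  obtain ⟨H, hH, hHm⟩ := Finset.exists_subset_card_eq (show m ≤ (Finset.univ.filter fun j =>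
    x j = c).card by omega)
  have hHc : ∀ i ∈ H, x i = c := fun i hi => (Finset.mem_filter.1 (hH hi)).2
  have hcard := choose_mul_choose_le_card (d := d) x hS hH hHm
  set 𝒜 := Finset.univ.filter fun A : Finset (Fin n) => Disjoint A H
    ∧ (A.filter fun j => x j = c).card = d ∧ (A.filter fun j => ¬ x j = c).card = d with h𝒜
  have hnot : ∀ i ∈ H, ∀ A ∈ 𝒜, i ∉ A := fun i hi A hA hiA =>
    Finset.disjoint_left.1 (Finset.mem_filter.1 hA).2.1 hiA hi
  have hstar : ∀ r s : ℝ, ∀ a ∈ H ×ˢ 𝒜, starProb r s x a.1 a.2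
      = r ^ d * (1 - r) ^ (S - 1 - d) * (s ^ d * (1 - s) ^ (n - S - d)) := by
    rintro r s ⟨i, A⟩ ha
    rw [Finset.mem_product] at ha
    have hA := (Finset.mem_filter.1 ha.2).2
    have hxi := hHc i ha.1
    exact starProb_eq x (hnot i ha.1 A ha.2) (by rw [hxi]; exact hS) (by rw [hxi]; exact hA.2.1)
      (by rw [hxi]; exact hA.2.2)
  set P := p ^ d * (1 - p) ^ (S - 1 - d) * (q ^ d * (1 - q) ^ (n - S - d)) with hP
  have hP0 : 0 ≤ P := by
    have h1 : 0 ≤ 1 - p := by linarith [hp1.2]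
    have h2 : 0 ≤ 1 - q := by linarith [hq1.2]
    have h3 := hp.1
    have h4 := hq.1
    positivity
  refine third_le_sum_of_second_moment (likelihood p q x) (likelihood_nonneg hp1 hq1 x) (H ×ˢ 𝒜)
    (fun a g => IsNeighborhood a.1 a.2 g) (Ambiguous p q x) (P := P) ?_ ?_ ?_ ?_
  · intro a ha g hg
    obtain ⟨R, hR, h1, h2⟩ := hg.exists_likelihood_eq hp1 hq1 x
    refine ⟨a.1, ?_⟩
    rw [h1, h2, hstar p q a ha, hstar q p a ha]
    exact mul_le_mul_of_nonneg_right (mul_pow_le_of_swap hp1 hq1 (by omega) hd hpq) hR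
  · intro a ha
    rw [sum_likelihood_isNeighborhood, hstar p q a ha]
  · intro a ha b hb hab
    have ha' := Finset.mem_product.1 ha
    have hb' := Finset.mem_product.1 hb
    by_cases hi : a.1 = b.1
    · refine le_trans (le_of_eq (Finset.sum_eq_zero fun g _ => ?_)) (by positivity :
        0 ≤ 2 * P ^ 2)
      by_cases h1 : IsNeighborhood a.1 a.2 g
      · by_cases h2 : IsNeighborhood b.1 b.2 g
        · rw [← hi] at h2
          exact absurd (Prod.ext hi (h1.eq h2 (hnot _ ha'.1 _ ha'.2) (hnot _ ha'.1 _ hb'.2))) hab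
        · simp [h2]
      · simp [h1]
    · refine (sum_likelihood_isNeighborhood_pair_le hp hq1 x hi
        ((hHc _ ha'.1).trans (hHc _ hb'.1).symm) (hnot _ hb'.1 _ ha'.2)
        (hnot _ ha'.1 _ hb'.2)).trans (le_of_eq ?_)
      rw [hstar p q a ha, hstar p q b hb, sq]
  · refine hN.trans (mul_le_mul_of_nonneg_right ?_ hP0)
    rw [Finset.card_product, hHm, mul_assoc]
    exact_mod_cast Nat.mul_le_mul_left m hcard

end AmbiguityProbability

section Balance

variable {n : ℕ}

theorem sum_sq_imbalance :
    ∑ x : Fin n → Fin 2, (2 * ((Finset.univ.filter fun j => x j = 0).card : ℝ) - (n : ℝ)) ^ 2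
      = (n : ℝ) * (2 : ℝ) ^ n := by
  let ξ : Fin 2 → ℝ := fun s => if s = 0 then 1 else -1
  have hflip : ∀ s : Fin 2, ξ (s + 1) = - ξ s := by
    intro s; fin_cases s <;> simp [ξ]
  have hsq : ∀ s : Fin 2, ξ s * ξ s = 1 := by
    intro s; fin_cases s <;> simp [ξ]
  have h1 : ∀ x : Fin n → Fin 2,
      2 * ((Finset.univ.filter fun j => x j = 0).card : ℝ) - n = ∑ j, ξ (x j) := by
    intro x
    have h2 : ∀ j, ξ (x j) = 2 * (if x j = 0 then 1 else 0) - 1 := by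
      intro j; simp only [ξ]; split_ifs <;> norm_num
    simp_rw [h2, Finset.sum_sub_distrib, ← Finset.mul_sum, Finset.sum_boole]
    simp
  have hpair : ∀ i j : Fin n, ∑ x : Fin n → Fin 2, ξ (x i) * ξ (x j)
      = if i = j then 2 ^ n else 0 := by
    intro i j
    split_ifs with hij
    · subst hij
      simp [hsq]
    · have h := Function.Bijective.sum_comp
        (Finite.injective_iff_bijective.1 (flipLabel_injective i))
        fun x : Fin n → Fin 2 => ξ (x i) * ξ (x j)
      simp only [flipLabel_apply_self, flipLabel_apply_of_ne (Ne.symm hij), hflip, neg_mul,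
        Finset.sum_neg_distrib] at h
      linarith
  simp_rw [h1, sq, Finset.sum_mul_sum]
  rw [Finset.sum_comm]
  simp_rw [Finset.sum_comm (s := (Finset.univ : Finset (Fin n → Fin 2))), hpair]
  simp

theorem half_le_card_balanced {η : ℝ} (hη : 0 < η) (hn : 2 ≤ η ^ 2 * n) :
    (2 : ℝ) ^ n / 2 ≤ ((Finset.univ.filter fun x : Fin n → Fin 2 =>
      |2 * ((Finset.univ.filter fun j => x j = 0).card : ℝ) - n| ≤ η * n).card : ℝ) := by
  set good := Finset.univ.filter fun x : Fin n → Fin 2 =>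
    |2 * ((Finset.univ.filter fun j => x j = 0).card : ℝ) - n| ≤ η * n with hgood
  have hcard : (goodᶜ.card : ℝ) = 2 ^ n - good.card := by
    have h := Finset.card_compl_add_card good
    rw [Fintype.card_fun, Fintype.card_fin, Fintype.card_fin] at h
    have h' : (goodᶜ.card : ℝ) + good.card = 2 ^ n := by exact_mod_cast h
    linarith
  have hbad : (goodᶜ.card : ℝ) * (η * n) ^ 2 ≤ n * 2 ^ n := by
    rw [← sum_sq_imbalance, ← nsmul_eq_mul]
    refine (Finset.card_nsmul_le_sum goodᶜ (fun x : Fin n → Fin 2 =>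
      (2 * ((Finset.univ.filter fun j => x j = 0).card : ℝ) - n) ^ 2) _ fun x hx => ?_).trans
      (Finset.sum_le_univ_sum_of_nonneg fun x => sq_nonneg _)
    rw [hgood, Finset.mem_compl, Finset.mem_filter, not_and, not_le] at hx
    rw [← sq_abs (_ - _)]
    exact pow_le_pow_left₀ (by positivity) (hx (Finset.mem_univ x)).le 2
  have hn0 : (0 : ℝ) < n := by
    rcases Nat.eq_zero_or_pos n with h | h
    · rw [h] at hn; norm_num at hn
    · exact_mod_cast h
  have h3 : (goodᶜ.card : ℝ) * (η ^ 2 * n) ≤ 2 ^ n := by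
    refine le_of_mul_le_mul_right ?_ hn0
    calc (goodᶜ.card : ℝ) * (η ^ 2 * n) * n = goodᶜ.card * (η * n) ^ 2 := by ring
      _ ≤ _ := hbad
      _ = _ := mul_comm _ _
  have h4 : (goodᶜ.card : ℝ) * 2 ≤ 2 ^ n :=
    (mul_le_mul_of_nonneg_left hn (Nat.cast_nonneg _)).trans h3
  linarith

end Balance

section LowerBound

variable {n : ℕ} {p q : ℝ}

/-- For odd `n`, one of the communities has the size required by the comparison of `p` and `q`. -/
theorem exists_community (hn : Odd n) (p q : ℝ) (x : Fin n → Fin 2) :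
    ∃ c : Fin 2, ∃ S : ℕ, (Finset.univ.filter fun j => x j = c).card = S ∧ S ≤ n
      ∧ |2 * (S : ℝ) - n| = |2 * ((Finset.univ.filter fun j => x j = 0).card : ℝ) - n|
      ∧ ((q ≤ p ∧ n - S ≤ S - 1) ∨ (p ≤ q ∧ S - 1 ≤ n - S)) := by
  obtain ⟨k, hk⟩ := hn
  set S₀ := (Finset.univ.filter fun j => x j = 0).card with hS₀
  have h1 : (Finset.univ.filter fun j => x j = 1).card + S₀ = n := by
    have h := Finset.card_filter_add_card_filter_not (s := (Finset.univ : Finset (Fin n)))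
      (fun j => x j = 0)
    have hfin : ∀ s : Fin 2, ¬ s = 0 ↔ s = 1 := by decide
    simp only [hfin, Finset.card_univ, Fintype.card_fin] at h
    omega
  have habs : |2 * (((Finset.univ.filter fun j => x j = 1).card : ℕ) : ℝ) - n|
      = |2 * (S₀ : ℝ) - n| := by
    have h2 : (((Finset.univ.filter fun j => x j = 1).card : ℕ) : ℝ) = n - S₀ := by
      rw [eq_sub_iff_add_eq]; exact_mod_cast h1
    rw [h2, ← abs_neg]
    congr 1
    ring
  rcases le_total q p with hpq | hpq <;> rcases le_or_gt S₀ k with hS | hS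
  · exact ⟨1, _, rfl, by omega, habs, Or.inl ⟨hpq, by omega⟩⟩
  · exact ⟨0, S₀, rfl, by omega, rfl, Or.inl ⟨hpq, by omega⟩⟩
  · exact ⟨0, S₀, rfl, by omega, rfl, Or.inr ⟨hpq, by omega⟩⟩
  · exact ⟨1, _, rfl, by omega, habs, Or.inr ⟨hpq, by omega⟩⟩

theorem sbmProb_le_of_balanced (hp : p ∈ Set.Icc (0 : ℝ) (1 / 2))
    (hq : q ∈ Set.Icc (0 : ℝ) (1 / 2)) (hodd : Odd n) (hn2 : 2 ≤ n) {η : ℝ} (hη : 0 < η)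
    (hn : 2 ≤ η ^ 2 * n) {m d : ℕ}
    (hmd : ∀ S ≤ n, |2 * (S : ℝ) - n| ≤ η * n → m + d ≤ S ∧ d ≤ n - S
      ∧ 1 ≤ (m * (S - m).choose d * (n - S).choose d : ℝ)
        * (p ^ d * (1 - p) ^ (S - 1 - d) * (q ^ d * (1 - q) ^ (n - S - d))))
    (est : (VPair n → Bool) → Fin n → Fin 2) :
    sbmProb (fun _ : Fin 2 => (1 : ℝ) / 2) (ssbmW 2 p q)
      (fun x g => agreement x (est g) = 1) ≤ 11 / 12 := by
  have hp1 : p ∈ Set.Icc (0 : ℝ) 1 := ⟨hp.1, by linarith [hp.2]⟩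
  have hq1 : q ∈ Set.Icc (0 : ℝ) 1 := ⟨hq.1, by linarith [hq.2]⟩
  rw [sbmProb_eq_one_sub]
  simp_rw [agreement_eq_one_iff (show 0 < n by omega)]
  have hupper : (∑ x : Fin n → Fin 2, ∑ g : VPair n → Bool,
        if Ambiguous p q x g then likelihood p q x g else 0)
      ≤ 2 * ∑ x, ∑ g, if SamePartition x (est g) then 0 else likelihood p q x g := by
    rw [Finset.sum_comm, Finset.sum_comm (f := fun x g =>
      if SamePartition x (est g) then 0 else likelihood p q x g), Finset.mul_sum]
    exact Finset.sum_le_sum fun g _ => sum_ambiguous_le hp1 hq1 hn2 (est g) g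
  have hnonneg : ∀ x : Fin n → Fin 2,
      0 ≤ ∑ g, if Ambiguous p q x g then likelihood p q x g else 0 := fun x =>
    Finset.sum_nonneg fun g _ => by
      have := likelihood_nonneg hp1 hq1 x g
      split_ifs <;> simp [this]
  set good := Finset.univ.filter fun x : Fin n → Fin 2 =>
    |2 * ((Finset.univ.filter fun j => x j = 0).card : ℝ) - n| ≤ η * n with hgood
  have hlower : (good.card : ℝ) * (1 / 3)
      ≤ ∑ x : Fin n → Fin 2, ∑ g : VPair n → Bool,
        if Ambiguous p q x g then likelihood p q x g else 0 := by
    rw [← nsmul_eq_mul]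
    refine (Finset.card_nsmul_le_sum good _ _ fun x hx => ?_).trans
      (Finset.sum_le_univ_sum_of_nonneg hnonneg)
    obtain ⟨c, S, hS, hSn, habs, hpq⟩ := exists_community hodd p q x
    obtain ⟨h1, h2, h3⟩ := hmd S hSn (habs ▸ (Finset.mem_filter.1 hx).2)
    exact third_le_sum_ambiguous hp hq x hS h1 h2 hpq h3
  have hhalf := half_le_card_balanced hη hn
  have hpow : (1 / 2 : ℝ) ^ n * 2 ^ n = 1 := by rw [← mul_pow]; norm_num
  have hpos : (0 : ℝ) < (1 / 2) ^ n := by positivity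
  set F := ∑ x : Fin n → Fin 2, ∑ g : VPair n → Bool,
    if SamePartition x (est g) then 0 else likelihood p q x g
  have hF : (2 : ℝ) ^ n / 12 ≤ F := by linarith
  have := mul_le_mul_of_nonneg_left hF hpos.le
  have h12 : (1 / 2 : ℝ) ^ n * (2 ^ n / 12) = 1 / 12 := by rw [← mul_div_assoc, hpow]
  linarith

end LowerBound

section ConverseAsymptotics

open Real Set

theorem exp_one_mul_pow_le (d : ℕ) :
    exp 1 * (d : ℝ) ^ (d + 1) ≤ ((d : ℝ) + 1) ^ (d + 1) := by
  rcases Nat.eq_zero_or_pos d with rfl | hd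
  · simp
  have hd0 : (0 : ℝ) < d := by exact_mod_cast hd
  have hx : (0 : ℝ) < (d + 1) / d := by positivity
  have h1 : (1 : ℝ) ≤ (d + 1 : ℕ) * Real.log ((d + 1) / d) := by
    have h := one_sub_inv_le_log_of_pos hx
    have h2 : 1 - ((d + 1 : ℝ) / d)⁻¹ = 1 / (d + 1) := by field_simp; ring
    rw [h2, div_le_iff₀ (by positivity)] at h
    push_cast
    linarith
  have h2 : exp 1 ≤ ((d + 1 : ℝ) / d) ^ (d + 1) := by
    calc exp 1 ≤ exp ((d + 1 : ℕ) * Real.log ((d + 1) / d)) := exp_le_exp.2 h1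
      _ = _ := by rw [exp_nat_mul, exp_log hx]
  rwa [div_pow, le_div_iff₀ (by positivity)] at h2

theorem factorial_mul_exp_le (d : ℕ) :
    (d.factorial : ℝ) * exp d ≤ exp 1 * (d + 1) * (d : ℝ) ^ d := by
  rcases Nat.eq_zero_or_pos d with rfl | hd
  · simp
  suffices h : (d.factorial : ℝ) * exp d ≤ exp 1 * (d : ℝ) ^ (d + 1) by
    refine h.trans ?_
    rw [pow_succ, mul_comm _ (d : ℝ), ← mul_assoc]
    gcongr
    linarith
  induction d, hd using Nat.le_induction with
  | base => simp
  | succ d _ ih =>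
    rw [Nat.factorial_succ]
    push_cast
    rw [exp_add, pow_succ _ (d + 1)]
    calc ((d : ℝ) + 1) * d.factorial * (exp d * exp 1)
        = (d + 1) * exp 1 * (d.factorial * exp d) := by ring
      _ ≤ (d + 1) * exp 1 * ((d + 1) ^ (d + 1)) :=
        mul_le_mul_of_nonneg_left (ih.trans (exp_one_mul_pow_le d)) (by positivity)
      _ = _ := by ring

theorem pow_div_factorial_le_choose {M : ℝ} (hM : 0 ≤ M) {N d : ℕ} (h : M + d ≤ N) :
    M ^ d / d.factorial ≤ N.choose d := by
  have hdN : d ≤ N := by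
    have : (d : ℝ) ≤ N := by linarith
    exact_mod_cast this
  refine le_trans ?_ (Nat.pow_le_choose d N)
  gcongr
  rw [Nat.cast_sub (by omega)]
  push_cast
  linarith

theorem sq_exp_div_le_choose_mul {M p q : ℝ} (hM : 0 ≤ M) (hp : 0 ≤ p) (hq : 0 ≤ q)
    {d N₁ N₂ : ℕ} (h1 : M + d ≤ N₁) (h2 : M + d ≤ N₂) (hd : (d : ℝ) ^ 2 ≤ (M * p) * (M * q)) :
    (exp d / (exp 1 * (d + 1))) ^ 2
      ≤ (N₁.choose d * p ^ d : ℝ) * (N₂.choose d * q ^ d : ℝ) := by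
  have hf : (0 : ℝ) < d.factorial := by exact_mod_cast d.factorial_pos
  have hle : exp d / (exp 1 * (d + 1)) ≤ (d : ℝ) ^ d / d.factorial := by
    rw [div_le_div_iff₀ (by positivity) hf]
    linarith [factorial_mul_exp_le d]
  calc (exp d / (exp 1 * (d + 1))) ^ 2 ≤ ((d : ℝ) ^ d / d.factorial) ^ 2 :=
        pow_le_pow_left₀ (by positivity) hle 2
    _ = ((d : ℝ) ^ 2) ^ d / (d.factorial : ℝ) ^ 2 := by
        rw [div_pow, ← pow_mul, ← pow_mul, mul_comm d 2]
    _ ≤ ((M * p) * (M * q)) ^ d / (d.factorial : ℝ) ^ 2 := by gcongr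
    _ = (M ^ d / d.factorial * p ^ d) * (M ^ d / d.factorial * q ^ d) := by
        rw [mul_pow, mul_pow, mul_pow]; ring
    _ ≤ _ := by
        have := pow_div_factorial_le_choose hM h1
        have := pow_div_factorial_le_choose hM h2
        gcongr

theorem exp_neg_le_one_sub_pow {η p K : ℝ} (hη : η ∈ Icc (0 : ℝ) 1) (hp : 0 ≤ p)
    (hpη : p ≤ η / 2) {k : ℕ} (hk : p * k ≤ K) : exp (-((1 + η) * K)) ≤ (1 - p) ^ k := by
  have hη0 := hη.1
  have hη1 := hη.2
  have h1 : 0 < 1 - p := by linarith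
  have h2 : -((1 + η) * p) ≤ Real.log (1 - p) := by
    refine le_trans ?_ (one_sub_inv_le_log_of_pos h1)
    rw [← one_div, one_sub_div h1.ne', le_div_iff₀ h1]
    nlinarith [mul_nonneg hp hη0]
  calc exp (-((1 + η) * K)) ≤ exp (k * Real.log (1 - p)) := by
        apply exp_le_exp.2
        have hk0 : (0 : ℝ) ≤ k := Nat.cast_nonneg k
        nlinarith [mul_le_mul_of_nonneg_left h2 hk0]
    _ = _ := by rw [exp_nat_mul, exp_log h1]

/-- A non-asymptotic form of the condition of `sbmProb_le_of_balanced`. -/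
theorem one_le_of_balanced {a b η δ : ℝ} (ha : 0 ≤ a) (hb : 0 ≤ b) (hη : 0 < η)
    (hη8 : η < 1 / 8) (hδ : 2 * δ = (1 - 4 * η) * √(a * b)) {n : ℕ} (hn : 0 < n)
    (hηn : 2 ≤ η * n)
    (hp : a * Real.log n / n ≤ η / 2) (hq : b * Real.log n / n ≤ η / 2)
    (hδn : δ * Real.log n / n ≤ η / 2)
    (hbig : exp 4 * (δ * Real.log n + 1) ^ 2
      ≤ η / 2 * exp ((1 + 2 * δ - (1 + η) ^ 2 * ((a + b) / 2)) * Real.log n))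
    {S : ℕ} (hS : S ≤ n) (hbal : |2 * (S : ℝ) - n| ≤ η * n) :
    ⌊η * n⌋₊ + ⌊δ * Real.log n⌋₊ ≤ S ∧ ⌊δ * Real.log n⌋₊ ≤ n - S ∧
      1 ≤ (⌊η * n⌋₊ * (S - ⌊η * n⌋₊).choose ⌊δ * Real.log n⌋₊
          * (n - S).choose ⌊δ * Real.log n⌋₊ : ℝ)
        * ((a * Real.log n / n) ^ ⌊δ * Real.log n⌋₊
            * (1 - a * Real.log n / n) ^ (S - 1 - ⌊δ * Real.log n⌋₊)
          * ((b * Real.log n / n) ^ ⌊δ * Real.log n⌋₊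
            * (1 - b * Real.log n / n) ^ (n - S - ⌊δ * Real.log n⌋₊))) := by
  have hn0 : (0 : ℝ) < n := by exact_mod_cast hn
  have hL : 0 ≤ Real.log n := Real.log_natCast_nonneg n
  set L := Real.log n with hLdef
  have hδ0 : 0 ≤ δ := by
    have : 0 ≤ (1 - 4 * η) * √(a * b) := mul_nonneg (by linarith) (sqrt_nonneg _)
    linarith
  set d := ⌊δ * L⌋₊
  set m := ⌊η * n⌋₊
  have hd1 : (d : ℝ) ≤ δ * L := Nat.floor_le (mul_nonneg hδ0 hL)
  have hd2 : δ * L - 1 ≤ d := by linarith [Nat.lt_floor_add_one (δ * L)]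
  have hm1 : (m : ℝ) ≤ η * n := Nat.floor_le (by positivity)
  have hm2 : η / 2 * n ≤ m := by linarith [Nat.lt_floor_add_one (η * n)]
  have hdn : (d : ℝ) ≤ η / 2 * n := by
    rw [div_le_iff₀ hn0] at hδn; linarith
  obtain ⟨hbal1, hbal2⟩ := abs_le.1 hbal
  have hηn8 : η * n < 1 / 8 * n := by gcongr
  have hSm : m ≤ S := by
    have : (m : ℝ) ≤ S := by linarith
    exact_mod_cast this
  have hcS : ((n - S : ℕ) : ℝ) = n - S := Nat.cast_sub hS
  have hcm : ((S - m : ℕ) : ℝ) = S - m := Nat.cast_sub hSm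
  refine ⟨?_, ?_, ?_⟩
  · have : ((m + d : ℕ) : ℝ) ≤ S := by push_cast; linarith
    exact_mod_cast this
  · have : (d : ℝ) ≤ ((n - S : ℕ) : ℝ) := by rw [hcS]; linarith
    exact_mod_cast this
  set p := a * L / n with hpdef
  set q := b * L / n with hqdef
  have hp0 : 0 ≤ p := by positivity
  have hq0 : 0 ≤ q := by positivity
  have hpn : p * n = a * L := by rw [hpdef]; field_simp
  have hqn : q * n = b * L := by rw [hqdef]; field_simp
  set M := (1 - 4 * η) / 2 * n with hMdef
  have hM : 0 ≤ M := mul_nonneg (by linarith) hn0.le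
  have hMd : (d : ℝ) ^ 2 ≤ (M * p) * (M * q) := by
    have h1 : (M * p) * (M * q) = (δ * L) ^ 2 := by
      have h2 : (2 * δ) ^ 2 = (1 - 4 * η) ^ 2 * (a * b) := by
        rw [hδ, mul_pow, sq_sqrt (mul_nonneg ha hb)]
      calc (M * p) * (M * q) = ((1 - 4 * η) / 2) ^ 2 * (p * n) * (q * n) := by rw [hMdef]; ring
        _ = (1 - 4 * η) ^ 2 * (a * b) / 4 * L ^ 2 := by rw [hpn, hqn]; ring
        _ = _ := by rw [← h2]; ring
    rw [h1]
    exact pow_le_pow_left₀ (Nat.cast_nonneg _) hd1 2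
  have hchoose := sq_exp_div_le_choose_mul hM hp0 hq0 (d := d) (N₁ := S - m) (N₂ := n - S)
    (by rw [hcm, hMdef]; linarith) (by rw [hcS, hMdef]; linarith) hMd
  have hη01 : η ∈ Icc (0 : ℝ) 1 := ⟨hη.le, by linarith⟩
  have hsize : ∀ c k : ℝ, 0 ≤ c → k ≤ (1 + η) / 2 * n →
      c * L / n * k ≤ (1 + η) * (c / 2) * L := fun c k hc hk => by
    calc c * L / n * k ≤ c * L / n * ((1 + η) / 2 * n) := by gcongr
      _ = _ := by field_simp
  have hk1 : ((S - 1 - d : ℕ) : ℝ) ≤ (1 + η) / 2 * n := by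
    have : ((S - 1 - d : ℕ) : ℝ) ≤ S := by exact_mod_cast (by omega)
    linarith
  have hk2 : ((n - S - d : ℕ) : ℝ) ≤ (1 + η) / 2 * n := by
    have : ((n - S - d : ℕ) : ℝ) ≤ ((n - S : ℕ) : ℝ) := by exact_mod_cast (by omega)
    linarith
  have hE1 := exp_neg_le_one_sub_pow hη01 hp0 hp (hsize a _ ha hk1)
  have hE2 := exp_neg_le_one_sub_pow hη01 hq0 hq (hsize b _ hb hk2)
  have hexpd : exp (2 * δ * L - 4) / (δ * L + 1) ^ 2 ≤ (exp d / (exp 1 * (d + 1))) ^ 2 := by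
    have h1 : exp (2 * δ * L - 4) / (δ * L + 1) ^ 2
        = (exp (δ * L - 1) / (exp 1 * (δ * L + 1))) ^ 2 := by
      rw [div_pow, mul_pow, ← exp_nat_mul, ← exp_nat_mul, ← div_div, ← exp_sub]
      congr 2
      push_cast
      ring
    rw [h1]
    gcongr
  have hm3 : η / 2 * exp L ≤ m := by rwa [hLdef, exp_log hn0]
  have hpos : 0 < δ * L + 1 := by positivity
  calc (1 : ℝ)
      ≤ η / 2 * exp ((1 + 2 * δ - (1 + η) ^ 2 * ((a + b) / 2)) * L)
          / (exp 4 * (δ * L + 1) ^ 2) := by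
        rw [one_le_div (by positivity)]; exact hbig
    _ = η / 2 * exp L * (exp (2 * δ * L - 4) / (δ * L + 1) ^ 2)
          * (exp (-((1 + η) * ((1 + η) * (a / 2) * L)))
            * exp (-((1 + η) * ((1 + η) * (b / 2) * L)))) := by
        have h1 : exp ((1 + 2 * δ - (1 + η) ^ 2 * ((a + b) / 2)) * L)
            = exp L * exp (2 * δ * L - 4) * exp 4
              * (exp (-((1 + η) * ((1 + η) * (a / 2) * L)))
                * exp (-((1 + η) * ((1 + η) * (b / 2) * L)))) := by
          simp only [← exp_add]
          congr 1
          ring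
        rw [h1]
        field_simp
    _ ≤ m * (((S - m).choose d * p ^ d : ℝ) * ((n - S).choose d * q ^ d : ℝ))
          * ((1 - p) ^ (S - 1 - d) * (1 - q) ^ (n - S - d)) := by
        have := hexpd.trans hchoose
        have hp1 : 0 ≤ 1 - p := by linarith
        have hq1 : 0 ≤ 1 - q := by linarith
        gcongr
    _ = _ := by ring

theorem eventually_mul_sq_le_exp {c δ ε κ : ℝ} (hε : 0 < ε) (hκ : 0 < κ) :
    ∀ᶠ L : ℝ in atTop, c * (δ * L + 1) ^ 2 ≤ ε * exp (κ * L) := by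
  have h1 : Tendsto (fun L : ℝ => (κ * L) ^ 2 * exp (-(κ * L))) atTop (nhds 0) :=
    (tendsto_pow_mul_exp_neg_atTop_nhds_zero 2).comp (tendsto_id.const_mul_atTop hκ)
  set C := |c| * (|δ| + 1) ^ 2 / κ ^ 2 + 1
  have hC : 0 < C := by positivity
  filter_upwards [h1.eventually_lt_const (div_pos hε hC), eventually_ge_atTop 1] with L h2 h3
  have h4 : (κ * L) ^ 2 * C ≤ ε * exp (κ * L) := by
    rw [exp_neg, ← div_eq_mul_inv, div_lt_div_iff₀ (exp_pos _) hC] at h2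
    exact h2.le
  have h5 : (δ * L + 1) ^ 2 ≤ ((|δ| + 1) * L) ^ 2 := by
    rw [← sq_abs (δ * L + 1)]
    refine pow_le_pow_left₀ (abs_nonneg _) ?_ 2
    calc |δ * L + 1| ≤ |δ * L| + |1| := abs_add_le _ _
      _ ≤ (|δ| + 1) * L := by
        rw [abs_mul, abs_one, abs_of_nonneg (zero_le_one.trans h3)]; linarith
  calc c * (δ * L + 1) ^ 2 ≤ |c| * ((|δ| + 1) * L) ^ 2 := by
        have := le_abs_self c
        gcongr
    _ = (κ * L) ^ 2 * (C - 1) := by simp only [C]; field_simp; ring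
    _ ≤ (κ * L) ^ 2 * C := by nlinarith [sq_nonneg (κ * L)]
    _ ≤ _ := h4

theorem exists_slack {a b : ℝ} (ha : 0 ≤ a) (hb : 0 ≤ b) (hab : |√a - √b| < √2) :
    ∃ η : ℝ, 0 < η ∧ η < 1 / 8 ∧
      0 < 1 + (1 - 4 * η) * √(a * b) - (1 + η) ^ 2 * ((a + b) / 2) := by
  have h0 : 0 < 1 + √(a * b) - (a + b) / 2 := by
    have h1 : (√a - √b) ^ 2 < 2 := by
      rw [← sq_abs, ← sq_sqrt (show (0 : ℝ) ≤ 2 by norm_num)]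
      exact pow_lt_pow_left₀ hab (abs_nonneg _) two_ne_zero
    rw [sqrt_mul ha]
    nlinarith [sq_sqrt ha, sq_sqrt hb]
  have hc : ContinuousAt
      (fun η : ℝ => 1 + (1 - 4 * η) * √(a * b) - (1 + η) ^ 2 * ((a + b) / 2)) 0 := by fun_prop
  have h1 : ∀ᶠ η in nhdsWithin (0 : ℝ) (Ioi 0),
      0 < 1 + (1 - 4 * η) * √(a * b) - (1 + η) ^ 2 * ((a + b) / 2) :=
    (hc.eventually_const_lt (by simpa using h0)).filter_mono nhdsWithin_le_nhds
  obtain ⟨η, h2, h3, h4⟩ := (h1.and (Ioo_mem_nhdsGT (show (0 : ℝ) < 1 / 8 by norm_num))).exists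
  exact ⟨η, h3, h4, h2⟩

/-- Below the threshold, every estimator fails with probability at least `1 / 12` on graphs of
large odd order. -/
theorem eventually_sbmProb_le {a b : ℝ} (ha : 0 ≤ a) (hb : 0 ≤ b) (hab : |√a - √b| < √2)
    (est : (n : ℕ) → (VPair n → Bool) → Fin n → Fin 2) :
    ∀ᶠ n : ℕ in atTop, Odd n →
      sbmProb (fun _ : Fin 2 => (1 : ℝ) / 2) (ssbmW 2 (a * Real.log n / n) (b * Real.log n / n))
        (fun x g => agreement x (est n g) = 1) ≤ 11 / 12 := by
  obtain ⟨η, hη, hη8, hκ⟩ := exists_slack ha hb hab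
  obtain ⟨δ, hδ⟩ : ∃ δ, 2 * δ = (1 - 4 * η) * √(a * b) := ⟨(1 - 4 * η) * √(a * b) / 2, by ring⟩
  have hδ0 : 0 ≤ δ := by
    have : 0 ≤ (1 - 4 * η) * √(a * b) := mul_nonneg (by linarith) (sqrt_nonneg _)
    linarith
  rw [← hδ] at hκ
  have hη2 : 0 < η / 2 := by positivity
  have hη3 : 0 < η ^ 2 := by positivity
  filter_upwards [eventually_mul_log_div_mem_Icc ha hη2, eventually_mul_log_div_mem_Icc hb hη2,
    eventually_mul_log_div_mem_Icc hδ0 hη2, eventually_ge_atTop 2,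
    (tendsto_natCast_atTop_atTop.const_mul_atTop hη).eventually_ge_atTop 2,
    (tendsto_natCast_atTop_atTop.const_mul_atTop hη3).eventually_ge_atTop 2,
    tendsto_log_natCast_atTop.eventually
      (eventually_mul_sq_le_exp (c := exp 4) (δ := δ) hη2 hκ)]
    with n hp hq hd hn2 hηn hηn2 hbig hodd
  exact sbmProb_le_of_balanced ⟨hp.1, by linarith [hp.2]⟩ ⟨hq.1, by linarith [hq.2]⟩ hodd hn2 hη
    hηn2 (fun S hS hbal => one_le_of_balanced ha hb hη hη8 hδ (by omega) hηn hp.2 hq.2 hd.2 hbig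
      hS hbal) (est n)

end ConverseAsymptotics

/-- Exact recovery threshold for `SSBM(n, 2, a log n / n, b log n / n)`:
solvable if `|√a − √b| > √2`, unsolvable if `|√a − √b| < √2`. -/
theorem exact_recovery_threshold_two_communities (a b : ℝ) (ha : 0 ≤ a) (hb : 0 ≤ b) :
    (Real.sqrt 2 < |Real.sqrt a - Real.sqrt b| →
      ∃ est : (n : ℕ) → (VPair n → Bool) → (Fin n → Fin 2),
        Tendsto
          (fun n : ℕ =>
            sbmProb (fun _ : Fin 2 => (1 : ℝ) / 2)
              (ssbmW 2 (a * Real.log n / n) (b * Real.log n / n))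
              fun x g => agreement x (est n g) = 1)
          atTop (nhds 1)) ∧
    (|Real.sqrt a - Real.sqrt b| < Real.sqrt 2 →
      ∀ est : (n : ℕ) → (VPair n → Bool) → (Fin n → Fin 2),
        ¬ Tendsto
          (fun n : ℕ =>
            sbmProb (fun _ : Fin 2 => (1 : ℝ) / 2)
              (ssbmW 2 (a * Real.log n / n) (b * Real.log n / n))
              fun x g => agreement x (est n g) = 1)
          atTop (nhds 1)) := by
  refine ⟨fun h => ⟨fun n g => mle (a * Real.log n / n) (b * Real.log n / n) g,
    exact_recovery_of_lt ha hb h⟩, fun h est hlim => ?_⟩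
  obtain ⟨n, ⟨h1, h2⟩, k, hk⟩ := (((eventually_sbmProb_le ha hb h est).and
    (hlim.eventually_const_lt (show (11 / 12 : ℝ) < 1 by norm_num))).and_frequently
      Nat.frequently_odd).exists
  linarith [h1 ⟨k, hk⟩]
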